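/- Let L and G be groups with a common subgroup H = L ∩ G, let F∗ = L ∗_H G, let R ⊆ F∗ be a symmetrized set satisfying condition C'(λ) for some real λ with 0 < λ ≤ 1/6, let N be the smallest normal subgroup of F∗ containing R, and let q : F∗ → F∗/N be the quotient homomorphism. Then: (1) every element w ∈ N \ {e} has length |w| > 1/λ − 3 ≥ 3; (2) the restriction of q to L ∪ G is injective; (3) q[H] = q[L] ∩ q[G]. -/

import Mathlib

open scoped Pointwise

namespace AmalgamFormalization

variable {F : Type u} [Group F]

/-- `u ∼ v`: both elements lie in `L` or both lie in `G`. -/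
def SameFactor (L G : Subgroup F) (u v : F) : Prop :=
  (u ∈ L ∧ v ∈ L) ∨ (u ∈ G ∧ v ∈ G)

/-- A canonical word: a list of elements of `L ∪ G` in which no two consecutive
entries lie in a common factor. -/
def IsCanonicalWord (L G : Subgroup F) (w : List F) : Prop :=
  (∀ x ∈ w, x ∈ (L : Set F) ∪ (G : Set F)) ∧
    w.Chain' fun a b => ¬ SameFactor L G a b

/-- `w` is a canonical representation of `x`. -/
def IsCanonicalRep (L G : Subgroup F) (x : F) (w : List F) : Prop :=
  IsCanonicalWord L G w ∧ w.prod = x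

/-- `F` is (internally) the free product of its subgroups `L` and `G`
amalgamated over `H = L ⊓ G`: it is generated by `L ∪ G` and no nonempty
alternating (canonical) word of length `≥ 2` represents the identity. -/
def IsAmalgam (L G : Subgroup F) : Prop :=
  L ⊔ G = ⊤ ∧ ∀ w : List F, IsCanonicalWord L G w → 2 ≤ w.length → w.prod ≠ 1

/-- The length of an element: the (common) length of its canonical representations. -/
noncomputable def len (L G : Subgroup F) (x : F) : ℕ :=
  sInf {n | ∃ w : List F, IsCanonicalRep L G x w ∧ w.length = n}

/-- An element is cyclically reduced if it has length `≤ 1` or admits a canonical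
representation whose first and last entries lie in no common factor. -/
def IsCyclicallyReduced (L G : Subgroup F) (x : F) : Prop :=
  len L G x ≤ 1 ∨ ∃ w : List F, IsCanonicalRep L G x w ∧
    ∀ a b : F, w.head? = some a → w.getLast? = some b → ¬ SameFactor L G a b

/-- An element is weakly cyclically reduced if it has length `≤ 1` or admits a canonical
representation `x₁ ⋯ xₙ` with `x₁ * xₙ ∉ H`. -/
def IsWeaklyCyclicallyReduced (L G : Subgroup F) (x : F) : Prop :=
  len L G x ≤ 1 ∨ ∃ w : List F, IsCanonicalRep L G x w ∧
    ∀ a b : F, w.head? = some a → w.getLast? = some b → a * b ∉ L ⊓ G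

/-- A set is half-symmetrized if all its elements are weakly cyclically reduced and it
contains every weakly cyclically reduced conjugate of each of its elements. -/
def IsHalfSymmetrized (L G : Subgroup F) (R : Set F) : Prop :=
  (∀ r ∈ R, IsWeaklyCyclicallyReduced L G r) ∧
    ∀ c : F, ∀ r ∈ R, IsWeaklyCyclicallyReduced L G (c * r * c⁻¹) → c * r * c⁻¹ ∈ R

/-- A set is symmetrized if it is half-symmetrized and closed under inverses. -/
def IsSymmetrized (L G : Subgroup F) (R : Set F) : Prop :=
  IsHalfSymmetrized L G R ∧ ∀ r ∈ R, r⁻¹ ∈ R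

/-- The half-symmetrized hull: the smallest half-symmetrized set containing `R`. -/
def halfSymmetrizedHull (L G : Subgroup F) (R : Set F) : Set F :=
  ⋂₀ {S | R ⊆ S ∧ IsHalfSymmetrized L G S}

/-- The symmetrized hull: the smallest symmetrized set containing `R`. -/
def symmetrizedHull (L G : Subgroup F) (R : Set F) : Set F :=
  ⋂₀ {S | R ⊆ S ∧ IsSymmetrized L G S}

/-- `a ≐ b c` : `a = b * c` and `|b| + |c| - 1 ≤ |a| ≤ |b| + |c|`. -/
def DotEq (L G : Subgroup F) (a b c : F) : Prop :=
  a = b * c ∧ len L G b + len L G c - 1 ≤ len L G a ∧ len L G a ≤ len L G b + len L G c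

/-- `p` is an `R`-piece of `r`. -/
def IsPieceOf (L G : Subgroup F) (R : Set F) (p r : F) : Prop :=
  ∃ q ∈ R, q ≠ r ∧ (∃ x, DotEq L G r p x) ∧ ∃ y, DotEq L G q p y

/-- The small cancellation condition `C'(λ)`. -/
def CondC' (L G : Subgroup F) (R : Set F) (lam : ℝ) : Prop :=
  (∀ r ∈ R, 1 / lam < (len L G r : ℝ)) ∧
    ∀ r ∈ R, ∀ p : F, IsPieceOf L G R p r → (len L G p : ℝ) < lam * (len L G r : ℝ)

/-- `H` is a malnormal subgroup of `K`. -/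
def MalnormalIn (H K : Subgroup F) : Prop :=
  ∀ x ∈ K, x ∉ H → ∀ h ∈ H, x * h * x⁻¹ ∈ H → h = 1

/-- An element `g` is `H`-malnormal: `g ∉ H` and `H ∩ gHg⁻¹ = {e}`. -/
def IsHMalnormal (H : Subgroup F) (g : F) : Prop :=
  g ∉ H ∧ ∀ h ∈ H, g * h * g⁻¹ ∈ H → h = 1

/-- A sequence `(g i)` is `H^±`-separated: `g i ∉ H (g j) H ∪ H (g j)⁻¹ H` for `i ≠ j`. -/
def HPMSeparated (H : Subgroup F) {n : ℕ} (g : Fin n → F) : Prop :=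
  ∀ i j : Fin n, i ≠ j →
    g i ∉ ((H : Set F) * {g j} * (H : Set F)) ∪ ((H : Set F) * {(g j)⁻¹} * (H : Set F))

/-- An element of positive even length is half `H⁻`-separated. -/
def IsHalfHMinusSeparated (L G : Subgroup F) (r : F) : Prop :=
  ∃ (n : ℕ) (x : Fin n → F), IsCanonicalRep L G r (List.ofFn x) ∧
    ∃ ε : Fin n, (ε : ℕ) ≤ 1 ∧
      ∀ i j : Fin n, Even (i : ℕ) → Even (j : ℕ) → i ≠ j →
        (x (ε + i))⁻¹ ∉
          ((L ⊓ G : Subgroup F) : Set F) * {x (ε + j)} * ((L ⊓ G : Subgroup F) : Set F)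

/-- A set is half `H⁻`-separated if each of its elements has positive even length and
is half `H⁻`-separated. -/
def IsHalfHMinusSeparatedSet (L G : Subgroup F) (R : Set F) : Prop :=
  ∀ r ∈ R, 0 < len L G r ∧ Even (len L G r) ∧ IsHalfHMinusSeparated L G r

end AmalgamFormalization


namespace AmalgamFormalization

/-! ### Discrete tree metrics -/

/-- `d` is the path metric of a (simplicial) tree. -/
structure TreeDist {V : Type*} (d : V → V → ℕ) : Prop where
  self : ∀ x, d x x = 0
  eq_of : ∀ x y, d x y = 0 → x = y
  symm : ∀ x y, d x y = d y x
  tri : ∀ x y z, d x z ≤ d x y + d y z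
  nb : ∀ x y, d x y ≠ 0 → ∃ x', d x x' = 1 ∧ d x y = d x' y + 1
  tree : ∀ m x' x y, d m x' = 1 → d m x = d x' x + 1 →
    d m y = d x' y + 1 ∨ d x y = d x m + d m y

namespace TreeDist

variable {V : Type*} {d : V → V → ℕ}

/-- geodesic convexity -/
def Conv (d : V → V → ℕ) (S : Set V) : Prop :=
  ∀ x ∈ S, ∀ y ∈ S, ∀ z, d x y = d x z + d z y → z ∈ S

/-- `p` is the gate (nearest point projection) of `x` in `S`. -/
def IsGate (d : V → V → ℕ) (S : Set V) (x p : V) : Prop :=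
  p ∈ S ∧ ∀ a ∈ S, d x a = d x p + d p a


theorem split (T : TreeDist d)
    {x y z : V} (p : V) (h : d y z = d y x + d x z) :
    d y p = d y x + d x p ∨ d p z = d p x + d x z := by
  by_cases hxy : d x y = 0
  · left
    have := T.eq_of _ _ hxy
    subst this
    simp [T.self]
  · obtain ⟨x', h1, h2⟩ := T.nb _ _ hxy
    rcases T.tree x x' y p h1 h2 with h3 | h3
    · rcases T.tree x x' p z h1 h3 with h4 | h4
      · exfalso
        have := T.tri y x' z
        have e1 := T.symm y x
        have e2 := T.symm y x'
        omega
      · exact Or.inr h4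
    · exact Or.inl h3

theorem median (T : TreeDist d)
    (x y z : V) :
    ∃ m, d x y = d x m + d m y ∧ d x z = d x m + d m z ∧ d y z = d y m + d m z := by
  induction hn : d x y generalizing x with
  | zero =>
    have := T.eq_of _ _ hn
    subst this
    exact ⟨x, by simp [T.self], by simp [T.self], by simp [T.self]⟩
  | succ n ih =>
    obtain ⟨x', h1, h2⟩ := T.nb x y (by omega)
    rcases T.tree x x' y z h1 h2 with h3 | h3
    · obtain ⟨m, a, b, c⟩ := ih x' (by omega)
      refine ⟨m, ?_, ?_, c⟩
      · have := T.tri x x' m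
        have := T.tri x m y
        omega
      · have := T.tri x x' m
        have := T.tri x m z
        omega
    · refine ⟨x, by simp [T.self, hn], by simp [T.self], h3⟩

theorem exists_gate (T : TreeDist d)
    {S : Set V} (hS : Conv d S) (hne : S.Nonempty) (x : V) :
    ∃ p, IsGate d S x p := by
  classical
  obtain ⟨s, hs⟩ := hne
  have hex : ∃ n, ∃ p ∈ S, d x p = n := ⟨_, s, hs, rfl⟩
  obtain ⟨p, hp, hpn⟩ := Nat.find_spec hex
  refine ⟨p, hp, fun a ha => ?_⟩
  obtain ⟨m, h1, h2, h3⟩ := T.median x p a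
  have hm : m ∈ S := hS p hp a ha m h3
  have hle : Nat.find hex ≤ d x m := Nat.find_min' hex ⟨m, hm, rfl⟩
  have : d m p = 0 := by omega
  have := T.eq_of _ _ this
  subst this
  exact h2

theorem gate_geo (T : TreeDist d)
    {S : Set V} {x y p q : V} (hp : IsGate d S x p) (hq : IsGate d S y q)
    (hne : p ≠ q) : d x y = d x p + d p q + d q y := by
  have h1 := hp.2 q hq.1
  have h2 := hq.2 p hp.1
  rcases T.split y h1 with h | h
  · have := T.symm y p; have := T.symm q p; have := T.symm y q; omega
  · exfalso
    have e := T.symm q p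
    have : d p q = 0 := by omega
    exact hne (T.eq_of _ _ this)

/-- Gates cannot be further apart than the points. -/
theorem gate_le (T : TreeDist d)
    {S : Set V} {x y p q : V} (hp : IsGate d S x p) (hq : IsGate d S y q) :
    d p q ≤ d x y := by
  by_cases h : p = q
  · subst h; simp [T.self]
  · have := T.gate_geo hp hq h; omega

/-- Projection of a point of `A'` to `A`, when both meet `W`. -/
theorem gate_mid (T : TreeDist d)
    {A A' W : Set V} (hA : Conv d A) (hA' : Conv d A') (hW : Conv d W)
    {w₀ w₁ z q : V} (hw0 : w₀ ∈ W) (hw0A : w₀ ∈ A) (hw1 : w₁ ∈ W) (hw1A : w₁ ∈ A')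
    (hz : z ∈ A') (hq : IsGate d A z q) :
    ∃ b ∈ W, b ∈ A ∧ (q = b ∨ (q ∈ A' ∧ b ∈ A')) := by
  by_cases hqA : q ∈ A'
  · obtain ⟨m, h1, h2, h3⟩ := T.median q w₀ w₁
    exact ⟨m, hW _ hw0 _ hw1 _ h3, hA _ hq.1 _ hw0A _ h1, Or.inr ⟨hqA, hA' _ hqA _ hw1A _ h2⟩⟩
  · obtain ⟨m, h1, h2, h3⟩ := T.median z w₀ w₁
    have hm : m ∈ W := hW _ hw0 _ hw1 _ h3
    have hm' : m ∈ A' := hA' _ hz _ hw1A _ h2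
    rcases T.split m (hq.2 _ hw0A) with h | h
    · exact absurd (hA' _ hz _ hm' _ h) hqA
    · exact ⟨q, hW _ hm _ hw0 _ h, hq.1, Or.inl rfl⟩

end TreeDist

/-! ### Windmills -/

section Windmill

variable {V : Type*} {F : Type*} [Group F] [MulAction F V]

/-- A family of axes with small overlaps in a tree. -/
structure AxisFamily (d : V → V → ℕ) (lam : ℝ) (𝒢 : Set F) (A : F → Set V) (τ : F → ℕ) :
    Prop where
  T : TreeDist d
  iso : ∀ (g : F) x y, d (g • x) (g • y) = d x y
  lam0 : 0 < lam
  lam6 : lam ≤ 1 / 6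
  conj : ∀ c, ∀ g ∈ 𝒢, c * g * c⁻¹ ∈ 𝒢
  Aconj : ∀ c g x, x ∈ A g → c • x ∈ A (c * g * c⁻¹)
  τconj : ∀ c g, τ (c * g * c⁻¹) = τ g
  τpos : ∀ g ∈ 𝒢, 0 < τ g
  ne : ∀ g ∈ 𝒢, (A g).Nonempty
  conv : ∀ g ∈ 𝒢, TreeDist.Conv d (A g)
  disp : ∀ g ∈ 𝒢, ∀ t ∈ Subgroup.zpowers g, t ≠ 1 → ∀ y ∈ A g, τ g ≤ d y (t • y)
  overlap : ∀ g ∈ 𝒢, ∀ g' ∈ 𝒢, g' ≠ g → g' ≠ g⁻¹ → ∀ x y, x ∈ A g → x ∈ A g' → y ∈ A g →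
    y ∈ A g' → (d x y : ℝ) < lam * τ g

/-- A windmill: a convex set with a group acting on it. -/
structure Good (d : V → V → ℕ) (lam : ℝ) (𝒢 : Set F) (A : F → Set V) (τ : F → ℕ) (K : ℝ) (e : V)
    (W : Set V) (M : Subgroup F) : Prop where
  conv : TreeDist.Conv d W
  base : e ∈ W
  inv : ∀ n ∈ M, ∀ x ∈ W, n • x ∈ W
  disp : ∀ w ∈ M, w ≠ 1 → K < d e (w • e)
  small : ∀ g ∈ 𝒢, g ∉ M → ∀ x y, x ∈ W → x ∈ A g → y ∈ W → y ∈ A g →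
    (d x y : ℝ) < 2 * lam * τ g

/-- Same axis. -/
def Same (a b : F) : Prop := b = a ∨ b = a⁻¹

theorem Same.symm {a b : F} (h : Same a b) : Same b a := by
  rcases h with rfl | rfl
  · exact Or.inl rfl
  · exact Or.inr (inv_inv _).symm

theorem Same.zpowers {a b : F} (h : Same a b) : Subgroup.zpowers b = Subgroup.zpowers a := by
  rcases h with rfl | rfl
  · rfl
  · exact Subgroup.zpowers_inv

theorem Same.conj {a b : F} (c : F) (h : Same (c * a * c⁻¹) (c * b * c⁻¹)) : Same a b := by
  rcases h with h | h
  · exact Or.inl (conj_injective h)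
  · right
    have : c * b * c⁻¹ = c * a⁻¹ * c⁻¹ := by rw [h]; group
    exact conj_injective this

namespace AxisFamily

variable {d : V → V → ℕ} {lam : ℝ} {𝒢 : Set F} {A : F → Set V} {τ : F → ℕ}
  {K : ℝ} {e : V}
  {W : Set V} {M : Subgroup F}


theorem Ainv (X : AxisFamily d lam 𝒢 A τ)
    {g t : F} (ht : t ∈ Subgroup.zpowers g) {x : V} (hx : x ∈ A g) : t • x ∈ A g := by
  have := X.Aconj t g x hx
  obtain ⟨k, rfl⟩ := Subgroup.mem_zpowers_iff.1 ht
  have e : g ^ k * g * (g ^ k)⁻¹ = g := by group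
  rwa [e] at this

theorem overlap_same (X : AxisFamily d lam 𝒢 A τ)
    {g g' : F} (hg : g ∈ 𝒢) (hg' : g' ∈ 𝒢) (h : ¬ Same g g') {x y : V}
    (h1 : x ∈ A g) (h2 : x ∈ A g') (h3 : y ∈ A g) (h4 : y ∈ A g') : (d x y : ℝ) < lam * τ g :=
  X.overlap g hg g' hg' (fun e => h (Or.inl e)) (fun e => h (Or.inr e)) x y h1 h2 h3 h4

/-- The layer of axes added in one step. -/
def layer (𝒢 : Set F) (A : F → Set V) (W : Set V) (M : Subgroup F) : Set F :=
  {g | g ∈ 𝒢 ∧ g ∉ M ∧ ∃ x ∈ W, x ∈ A g}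

/-- the projection of `y` to the axis of `g` is near `W`. -/
def Near (d : V → V → ℕ) (lam : ℝ) (A : F → Set V) (τ : F → ℕ) (W : Set V) (g : F) (y : V) :
    Prop :=
  ∃ p b, TreeDist.IsGate d (A g) y p ∧ b ∈ W ∧ b ∈ A g ∧ (d p b : ℝ) < lam * τ g

theorem lam_pos (X : AxisFamily d lam 𝒢 A τ)
    {g : F} (hg : g ∈ 𝒢) : 0 < lam * τ g :=
  mul_pos X.lam0 (by exact_mod_cast X.τpos g hg)

theorem lam_six (X : AxisFamily d lam 𝒢 A τ)
    {g : F} : 6 * (lam * τ g) ≤ τ g := by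
  have := X.lam6
  have : (0 : ℝ) ≤ τ g := by positivity
  nlinarith

theorem near_W (X : AxisFamily d lam 𝒢 A τ)
    (hG : Good d lam 𝒢 A τ K e W M) {g : F} (hg : g ∈ layer 𝒢 A W M) {y : V}
    (hy : y ∈ W) : ∃ p, TreeDist.IsGate d (A g) y p ∧ p ∈ W := by
  obtain ⟨hg, hgM, w, hwW, hwA⟩ := hg
  obtain ⟨p, hp⟩ := X.T.exists_gate (X.conv g hg) (X.ne g hg) y
  exact ⟨p, hp, hG.conv _ hy _ hwW _ (hp.2 _ hwA)⟩

theorem near_of_W (X : AxisFamily d lam 𝒢 A τ)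
    (hG : Good d lam 𝒢 A τ K e W M) {g : F} (hg : g ∈ layer 𝒢 A W M) {y : V}
    (hy : y ∈ W) : Near d lam A τ W g y := by
  obtain ⟨p, hp, hpW⟩ := X.near_W hG hg hy
  exact ⟨p, p, hp, hpW, hp.1, by simpa [X.T.self] using X.lam_pos hg.1⟩

theorem near_of_axis (X : AxisFamily d lam 𝒢 A τ)
    (hG : Good d lam 𝒢 A τ K e W M) {g g' : F} (hg : g ∈ layer 𝒢 A W M)
    (hg' : g' ∈ layer 𝒢 A W M) (hs : ¬ Same g g') {y : V}
    (hy : y ∈ A g') : Near d lam A τ W g y := by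
  obtain ⟨hg, hgM, w, hwW, hwA⟩ := hg
  obtain ⟨hg', hgM', w', hwW', hwA'⟩ := hg'
  obtain ⟨p, hp⟩ := X.T.exists_gate (X.conv g hg) (X.ne g hg) y
  obtain ⟨b, hbW, hbA, hb⟩ := X.T.gate_mid (X.conv g hg) (X.conv g' hg') hG.conv hwW hwA hwW' hwA'
    hy hp
  refine ⟨p, b, hp, hbW, hbA, ?_⟩
  rcases hb with rfl | ⟨h1, h2⟩
  · simpa [X.T.self] using X.lam_pos hg
  · exact X.overlap_same hg hg' hs hp.1 h1 hbA h2

theorem gate_smul (X : AxisFamily d lam 𝒢 A τ)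
    {g t : F} (ht : t ∈ Subgroup.zpowers g) {y p : V}
    (hp : TreeDist.IsGate d (A g) y p) : TreeDist.IsGate d (A g) (t • y) (t • p) := by
  refine ⟨X.Ainv ht hp.1, fun a ha => ?_⟩
  have := hp.2 (t⁻¹ • a) (X.Ainv (inv_mem ht) ha)
  rw [← X.iso t y, ← X.iso t y, ← X.iso t p, smul_inv_smul] at this
  exact this

/-- After turning around the axis of `g`, one is far away from `W`. -/
theorem far (X : AxisFamily d lam 𝒢 A τ)
    (hG : Good d lam 𝒢 A τ K e W M) {g t : F} (hg : g ∈ layer 𝒢 A W M)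
    (ht : t ∈ Subgroup.zpowers g) (ht1 : t ≠ 1) {p b c : V}
    (hb : b ∈ W) (hbA : b ∈ A g) (hpb : (d p b : ℝ) < lam * τ g) (hc : c ∈ W) (hcA : c ∈ A g) :
    (τ g : ℝ) - 3 * (lam * τ g) < d c (t • p) := by
  have h1 := X.disp g hg.1 t ht ht1 c hcA
  have h2 := hG.small g hg.1 hg.2.1 c b hc hcA hb hbA
  have h3 : d c (t • c) ≤ d c (t • p) + d p b + d c b := by
    have a1 := X.T.tri c (t • p) (t • c)
    have a2 := X.iso t p c
    have a3 := X.T.tri p b c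
    have a4 := X.T.symm b c
    omega
  have h4 : (τ g : ℝ) ≤ d c (t • p) + d p b + d c b := by exact_mod_cast h1.trans h3
  linarith

theorem near_step (X : AxisFamily d lam 𝒢 A τ)
    (hG : Good d lam 𝒢 A τ K e W M) {g g' t : F} (hg : g ∈ layer 𝒢 A W M)
    (hg' : g' ∈ layer 𝒢 A W M) (hs : ¬ Same g g') {y : V} (ht : t ∈ Subgroup.zpowers g')
    (ht1 : t ≠ 1) (hy : Near d lam A τ W g' y) : Near d lam A τ W g (t • y) := by
  obtain ⟨p', b', hp', hb'W, hb'A, hpb⟩ := hy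
  have hz := X.gate_smul ht hp'
  obtain ⟨q, b, hq, hbW, hbA, hqb⟩ := X.near_of_axis hG hg hg' hs hz.1
  refine ⟨q, b, ⟨hq.1, ?_⟩, hbW, hbA, hqb⟩
  have key : ∀ a ∈ A g, d (t • y) a = d (t • y) (t • p') + d (t • p') a := by
    intro a ha
    obtain ⟨c, hc⟩ := X.T.exists_gate (X.conv g' hg'.1) (X.ne g' hg'.1) a
    by_cases hcz : t • p' = c
    · exfalso
      obtain ⟨_, _, w, hwW, hwA⟩ := hg
      obtain ⟨_, _, w', hwW', hwA'⟩ := id hg'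
      obtain ⟨m, hmW, hmA, hm⟩ := X.T.gate_mid (X.conv g' hg'.1) (X.conv g ‹_›) hG.conv hwW' hwA'
        hwW hwA ha hc
      have h6 := X.lam_six (g := g')
      have h0 := X.lam_pos hg'.1
      have hf := X.far hG hg' ht ht1 hb'W hb'A hpb hmW hmA
      rw [hcz] at hf
      rcases hm with rfl | ⟨h1, h2⟩
      · simp [X.T.self] at hf
        linarith
      · have := X.overlap_same hg'.1 ‹_› (fun h => hs h.symm) hmA h2 hc.1 h1
        linarith
    · have h1 := X.T.gate_geo hz hc hcz
      have h2 := X.T.tri (t • p') c a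
      have h3 := X.T.tri (t • y) (t • p') a
      omega
  intro a ha
  have h1 := key a ha
  have h2 := key q hq.1
  have h3 := hq.2 a ha
  omega

/-- Reduced words in the layer. -/
def Red (B : Set F) (l : List (F × F)) : Prop :=
  (∀ p ∈ l, p.1 ∈ B ∧ p.2 ∈ Subgroup.zpowers p.1 ∧ p.2 ≠ 1) ∧
    l.IsChain fun p q => ¬ Same p.1 q.1

def val (l : List (F × F)) : F := (l.map Prod.snd).prod

theorem near_word (X : AxisFamily d lam 𝒢 A τ)
    (hG : Good d lam 𝒢 A τ K e W M) {g : F} (hg : g ∈ layer 𝒢 A W M)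
    {y : V} (l : List (F × F)) (hl : Red (layer 𝒢 A W M) l)
    (hh : ∀ p ∈ l.head?, ¬ Same g p.1)
    (hy : ∀ g' ∈ layer 𝒢 A W M, (∀ p ∈ l.getLast?, g' = p.1) → (l = [] → g' = g) →
      Near d lam A τ W g' y) :
    Near d lam A τ W g (val l • y) := by
  induction l generalizing g with
  | nil => simpa [val] using hy g hg (by simp) (by simp)
  | cons p l ih =>
    obtain ⟨g', t⟩ := p
    have hp := hl.1 (g', t) (by simp)
    have hs := hh (g', t) (by simp)
    simp only at hp hs
    have : val ((g', t) :: l) = t * val l := by simp [val]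
    rw [this, mul_smul]
    refine X.near_step hG hg hp.1 hs hp.2.1 hp.2.2 (ih hp.1 ⟨fun q hq => hl.1 q (by simp [hq]), ?_⟩
      ?_ ?_)
    · exact (List.isChain_cons.1 hl.2).2
    · intro q hq
      exact (List.isChain_cons.1 hl.2).1 q hq
    · intro g'' hg'' h1 h2
      refine hy g'' hg'' ?_ (by simp)
      intro q hq
      rcases l with _ | ⟨p, l⟩
      · simp at hq
        subst hq
        exact h2 rfl
      · rw [List.getLast?_cons_cons] at hq
        exact h1 q hq

theorem layer_conj (X : AxisFamily d lam 𝒢 A τ)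
    (hG : Good d lam 𝒢 A τ K e W M) {g n : F} (hg : g ∈ layer 𝒢 A W M)
    (hn : n ∈ M) : n * g * n⁻¹ ∈ layer 𝒢 A W M := by
  obtain ⟨h1, h2, x, hx, hxA⟩ := hg
  refine ⟨X.conj n g h1, fun h => h2 ?_, n • x, hG.inv n hn x hx, X.Aconj n g x hxA⟩
  have := M.mul_mem (M.mul_mem (M.inv_mem hn) h) hn
  convert this using 1
  group

theorem red_mul {B : Set F} {g t : F} (hg : g ∈ B) (ht : t ∈ Subgroup.zpowers g)
    (l : List (F × F)) (hl : Red B l) : ∃ l', Red B l' ∧ t * val l = val l' := by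
  by_cases ht1 : t = 1
  · exact ⟨l, hl, by simp [ht1]⟩
  rcases l with _ | ⟨⟨g₁, t₁⟩, l⟩
  · refine ⟨[(g, t)], ⟨?_, by simp⟩, by simp [val]⟩
    simp [hg, ht, ht1]
  · by_cases hs : Same g g₁
    · have h1 := hl.1 (g₁, t₁) (by simp)
      simp only at h1
      have ht' : t * t₁ ∈ Subgroup.zpowers g₁ := mul_mem (by rw [hs.zpowers]; exact ht) h1.2.1
      have hc := List.isChain_cons.1 hl.2
      by_cases h2 : t * t₁ = 1
      · refine ⟨l, ⟨fun q hq => hl.1 q (by simp [hq]), hc.2⟩, ?_⟩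
        simp [val, ← mul_assoc, h2]
      · refine ⟨(g₁, t * t₁) :: l, ⟨?_, List.isChain_cons.2 ⟨hc.1, hc.2⟩⟩, by simp [val, mul_assoc]⟩
        intro q hq
        rcases List.mem_cons.1 hq with rfl | hq
        · exact ⟨h1.1, ht', h2⟩
        · exact hl.1 q (by simp [hq])
    · refine ⟨(g, t) :: (g₁, t₁) :: l, ⟨?_, List.isChain_cons.2 ⟨by simpa using hs, hl.2⟩⟩,
        by simp [val]⟩
      intro q hq
      rcases List.mem_cons.1 hq with rfl | hq
      · exact ⟨hg, ht, ht1⟩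
      · exact hl.1 q hq

/-- The enlarged group. -/
def bigM (𝒢 : Set F) (A : F → Set V) (W : Set V) (M : Subgroup F) : Subgroup F :=
  Subgroup.closure ((M : Set F) ∪ layer 𝒢 A W M)

/-- The enlarged convex set. -/
def bigW (𝒢 : Set F) (A : F → Set V) (W : Set V) (M : Subgroup F) : Set V :=
  {x | ∃ h ∈ bigM 𝒢 A W M, ∃ y, x = h • y ∧ (y ∈ W ∨ ∃ g ∈ layer 𝒢 A W M, y ∈ A g)}

theorem normal_form (X : AxisFamily d lam 𝒢 A τ)
    (hG : Good d lam 𝒢 A τ K e W M) {h : F} (hh : h ∈ bigM 𝒢 A W M) :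
    ∃ l, Red (layer 𝒢 A W M) l ∧ ∃ n ∈ M, h = val l * n := by
  have hmul : ∀ s, (s ∈ M ∨ ∃ g ∈ layer 𝒢 A W M, s ∈ Subgroup.zpowers g) → ∀ h,
      (∃ l, Red (layer 𝒢 A W M) l ∧ ∃ n ∈ M, h = val l * n) →
      (∃ l, Red (layer 𝒢 A W M) l ∧ ∃ n ∈ M, s * h = val l * n) := by
    rintro s hs _ ⟨l, hl, n, hn, rfl⟩
    rcases hs with hs | ⟨g, hg, hs⟩
    · refine ⟨l.map (fun p => (s * p.1 * s⁻¹, s * p.2 * s⁻¹)), ⟨?_, ?_⟩, s * n, M.mul_mem hs hn, ?_⟩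
      · intro q hq
        obtain ⟨p, hp, rfl⟩ := List.mem_map.1 hq
        have := hl.1 p hp
        refine ⟨X.layer_conj hG this.1 hs, ?_, ?_⟩
        · obtain ⟨k, hk⟩ := Subgroup.mem_zpowers_iff.1 this.2.1
          simp only [← hk]
          exact Subgroup.mem_zpowers_iff.2 ⟨k, conj_zpow⟩
        · simpa using this.2.2
      · rw [List.isChain_map]
        exact hl.2.imp fun p q h h' => h (Same.conj s h')
      · have : ∀ l : List (F × F), val (l.map (fun p => (s * p.1 * s⁻¹, s * p.2 * s⁻¹))) =
            s * val l * s⁻¹ := by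
          intro l
          induction l with
          | nil => simp [val]
          | cons p l ih =>
            simp only [val, List.map_cons, List.prod_cons] at ih ⊢
            rw [ih]
            group
        rw [this]
        group
    · obtain ⟨l', hl', e'⟩ := red_mul hg hs l hl
      exact ⟨l', hl', n, hn, by rw [← mul_assoc, e']⟩
  unfold bigM at hh
  induction hh using Subgroup.closure_induction_left with
  | one => exact ⟨[], ⟨by simp, by simp⟩, 1, M.one_mem, by simp [val]⟩
  | mul_left x hx y hy ih =>
    refine hmul x ?_ y ih
    rcases hx with hx | hx
    · exact Or.inl hx
    · exact Or.inr ⟨x, hx, Subgroup.mem_zpowers x⟩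
  | inv_mul_cancel x hx y hy ih =>
    refine hmul x⁻¹ ?_ y ih
    rcases hx with hx | hx
    · exact Or.inl (M.inv_mem hx)
    · exact Or.inr ⟨x, hx, inv_mem (Subgroup.mem_zpowers x)⟩

end AxisFamily
end Windmill
end AmalgamFormalization

namespace AmalgamFormalization
namespace AxisFamily

variable {V : Type*} {F : Type*} [Group F] [MulAction F V]
variable {d : V → V → ℕ} {lam : ℝ} {𝒢 : Set F} {A : F → Set V} {τ : F → ℕ}
  {K : ℝ} {e : V}
  {W : Set V} {M : Subgroup F}


theorem big_disp (X : AxisFamily d lam 𝒢 A τ)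
    (hG : Good d lam 𝒢 A τ K e W M)
    (hK : ∀ g ∈ 𝒢, K ≤ (τ g : ℝ) - 3 * (lam * τ g)) {h : F}
    (hh : h ∈ bigM 𝒢 A W M) (h1 : h ≠ 1) : K < d e (h • e) := by
  obtain ⟨l, hl, n, hn, rfl⟩ := X.normal_form hG hh
  rcases l with _ | ⟨⟨g, t⟩, l⟩
  · simp only [val, List.map_nil, List.prod_nil, one_mul] at h1 ⊢
    exact hG.disp n hn h1
  · have hp := hl.1 (g, t) (by simp)
    simp only at hp
    have hc := List.isChain_cons.1 hl.2
    have hnear : Near d lam A τ W g (val l • (n • e)) := by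
      refine X.near_word hG hp.1 l ⟨fun q hq => hl.1 q (by simp [hq]), hc.2⟩ hc.1 ?_
      intro g' hg' _ _
      exact X.near_of_W hG hg' (hG.inv n hn e hG.base)
    obtain ⟨p, b, hpg, hbW, hbA, hpb⟩ := hnear
    obtain ⟨c, hc1, hc2⟩ := X.near_W hG hp.1 hG.base
    have hf := X.far hG hp.1 hp.2.1 hp.2.2 hbW hbA hpb hc2 hc1.1
    have hle := X.T.gate_le hc1 (X.gate_smul hp.2.1 hpg)
    have e1 : (val ((g, t) :: l) * n) • e = t • val l • n • e := by
      simp [val, mul_smul]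
    rw [e1]
    have hle' : (d c (t • p) : ℝ) ≤ d e (t • val l • n • e) := by exact_mod_cast hle
    have := hK g hp.1.1
    linarith

theorem M_le : M ≤ bigM 𝒢 A W M := fun _ hx =>
  Subgroup.subset_closure (Or.inl hx)

theorem layer_le {g : F} (hg : g ∈ layer 𝒢 A W M) : g ∈ bigM 𝒢 A W M :=
  Subgroup.subset_closure (Or.inr hg)

theorem W_le : W ⊆ bigW 𝒢 A W M := fun x hx =>
  ⟨1, Subgroup.one_mem _, x, by simp, Or.inl hx⟩

theorem big_inv {n : F} (hn : n ∈ bigM 𝒢 A W M) {x : V} (hx : x ∈ bigW 𝒢 A W M) :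
    n • x ∈ bigW 𝒢 A W M := by
  obtain ⟨h, hh, y, rfl, hy⟩ := hx
  exact ⟨n * h, mul_mem hn hh, y, by rw [mul_smul], hy⟩

theorem big_seg (X : AxisFamily d lam 𝒢 A τ)
    (hG : Good d lam 𝒢 A τ K e W M) {h : F} (hh : h ∈ bigM 𝒢 A W M) {y : V}
    (hy : y ∈ W ∨ ∃ g ∈ layer 𝒢 A W M, y ∈ A g) :
    ∀ z, d e (h • y) = d e z + d z (h • y) → z ∈ bigW 𝒢 A W M := by
  have hgen : ∀ s ∈ ((M : Set F) ∪ layer 𝒢 A W M), ∀ s', s' = s ∨ s' = s⁻¹ →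
      ∀ z, d e (s' • e) = d e z + d z (s' • e) → z ∈ bigW 𝒢 A W M := by
    intro s hs s' hs' z hz
    rcases hs with hs | hs
    · have : s' ∈ M := by
        rcases hs' with rfl | rfl
        · exact hs
        · exact M.inv_mem hs
      exact W_le (hG.conv e hG.base _ (hG.inv s' this e hG.base) z hz)
    · have hs1 : s' ∈ Subgroup.zpowers s := by
        rcases hs' with rfl | rfl
        · exact Subgroup.mem_zpowers _
        · exact inv_mem (Subgroup.mem_zpowers _)
      have hs2 : s' ∈ bigM 𝒢 A W M := by
        rcases hs' with rfl | rfl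
        · exact layer_le hs
        · exact inv_mem (layer_le hs)
      obtain ⟨hsG, _, a, haW, haA⟩ := id hs
      rcases X.T.split a hz with h | h
      · exact W_le (hG.conv e hG.base a haW z h)
      · rcases X.T.split (s' • a) h with h | h
        · exact ⟨1, one_mem _, z, by simp, Or.inr ⟨s, hs,
            X.conv s hsG a haA _ (X.Ainv hs1 haA) z h⟩⟩
        · refine ⟨s', hs2, s'⁻¹ • z, by simp, Or.inl (hG.conv a haW e hG.base _ ?_)⟩
          rw [← X.iso s' a e, ← X.iso s' a, ← X.iso s' _ e]
          simpa using h
  unfold bigM at hh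
  induction hh using Subgroup.closure_induction_left with
  | one =>
    intro z hz
    rw [one_smul] at hz
    rcases hy with hy | ⟨g, hg, hy⟩
    · exact W_le (hG.conv e hG.base y hy z hz)
    · obtain ⟨hgG, _, a, haW, haA⟩ := id hg
      rcases X.T.split a hz with h | h
      · exact W_le (hG.conv e hG.base a haW z h)
      · exact ⟨1, one_mem _, z, by simp, Or.inr ⟨g, hg, X.conv g hgG a haA _ hy z h⟩⟩
  | mul_left s hs h hh ih =>
    intro z hz
    rcases X.T.split (s • e) hz with h1 | h1
    · exact hgen s hs s (Or.inl rfl) z h1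
    · have := ih (s⁻¹ • z) (by
        rw [← X.iso s e, ← X.iso s e, ← X.iso s _ (h • y)]
        simpa [mul_smul] using h1)
      have := big_inv (Subgroup.subset_closure hs : s ∈ bigM 𝒢 A W M) this
      simpa using this
  | inv_mul_cancel s hs h hh ih =>
    intro z hz
    rcases X.T.split (s⁻¹ • e) hz with h1 | h1
    · exact hgen s hs s⁻¹ (Or.inr rfl) z h1
    · have := ih (s • z) (by
        rw [← X.iso s⁻¹ e, ← X.iso s⁻¹ e, ← X.iso s⁻¹ _ (h • y)]
        simpa [mul_smul] using h1)
      have := big_inv (inv_mem (Subgroup.subset_closure hs) : s⁻¹ ∈ bigM 𝒢 A W M) this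
      simpa using this

theorem big_conv (X : AxisFamily d lam 𝒢 A τ)
    (hG : Good d lam 𝒢 A τ K e W M) : TreeDist.Conv d (bigW 𝒢 A W M) := by
  rintro _ ⟨h, hh, x, rfl, hx⟩ _ ⟨h', hh', y, rfl, hy⟩ z hz
  rcases X.T.split e hz with h1 | h1
  · refine X.big_seg hG hh hx z ?_
    have e1 := X.T.symm e (h • x)
    have e2 := X.T.symm e z
    have e3 := X.T.symm z (h • x)
    omega
  · exact X.big_seg hG hh' hy z h1

/-- An axis outside the new group meets no translate of `W`. -/
theorem axis_disj (X : AxisFamily d lam 𝒢 A τ)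
    (c : F) (hc : c ∈ 𝒢) (hcM : c ∉ bigM 𝒢 A W M) {x : V}
    (hx : x ∈ A c) : x ∉ W := fun hxW =>
  hcM (layer_le ⟨hc, fun h => hcM (M_le h), x, hxW, hx⟩)

theorem big_small_word (X : AxisFamily d lam 𝒢 A τ)
    (hG : Good d lam 𝒢 A τ K e W M) (N : ℕ) :
    ∀ l : List (F × F), l.length = N → Red (layer 𝒢 A W M) l →
    ∀ a ∈ layer 𝒢 A W M, ∀ b ∈ layer 𝒢 A W M, ∀ c ∈ 𝒢, c ∉ bigM 𝒢 A W M →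
    ∀ p y, p ∈ A a → y ∈ A b → p ∈ A c → val l • y ∈ A c →
      (d p (val l • y) : ℝ) < 2 * lam * τ c := by
  have hns : ∀ g ∈ layer 𝒢 A W M, ∀ c, c ∉ bigM 𝒢 A W M → ¬ Same g c := by
    intro g hg c hc h
    apply hc
    rcases h with rfl | rfl
    · exact layer_le hg
    · exact inv_mem (layer_le hg)
  induction N with
  | zero =>
    intro l hl _ a ha b hb c hc hcM p y hp hy hpc hyc
    rw [List.length_eq_zero_iff] at hl
    subst hl
    simp only [val, List.map_nil, List.prod_nil, one_smul] at hyc ⊢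
    obtain ⟨haG, _, a', haW, haA⟩ := id ha
    obtain ⟨hbG, _, b', hbW, hbA⟩ := id hb
    have hne : W.Nonempty := ⟨e, hG.base⟩
    obtain ⟨u, hu⟩ := X.T.exists_gate hG.conv hne p
    obtain ⟨u', hu'⟩ := X.T.exists_gate hG.conv hne y
    have huu : u = u' := by
      by_contra hne
      have h1 := X.T.gate_geo hu hu' hne
      have : u ∈ A c := X.conv c hc p hpc y hyc u (by
        have := X.T.tri u u' y
        have := X.T.tri p u y
        omega)
      exact X.axis_disj c hc hcM this hu.1
    subst huu
    have hua : u ∈ A a := X.conv a haG p hp a' haA u (hu.2 _ haW)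
    have hub : u ∈ A b := X.conv b hbG y hy b' hbA u (hu'.2 _ hbW)
    obtain ⟨m, h1, h2, h3⟩ := X.T.median p y u
    have hmc : m ∈ A c := X.conv c hc p hpc y hyc m h1
    have hma : m ∈ A a := X.conv a haG p hp u hua m h2
    have hmb : m ∈ A b := X.conv b hbG y hy u hub m h3
    have k1 := X.overlap_same hc haG (fun h => hns a ha c hcM h.symm) hpc hp hmc hma
    have k2 := X.overlap_same hc hbG (fun h => hns b hb c hcM h.symm) hmc hmb hyc hy
    have k3 : (d p y : ℝ) = d p m + d m y := by exact_mod_cast h1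
    linarith
  | succ N ih =>
    intro l hl hr a ha b hb c hc hcM p y hp hy hpc hyc
    -- last letter
    by_cases hlast : ∃ q ∈ l.getLast?, Same b q.1
    · obtain ⟨q, hq, hs⟩ := hlast
      obtain ⟨l₀, rfl⟩ : ∃ l₀, l = l₀ ++ [q] := 
        ⟨l.dropLast, (List.dropLast_append_getLast? q hq).symm⟩
      have hqr := hr.1 q (by simp)
      have ev : val (l₀ ++ [q]) • y = val l₀ • (q.2 • y) := by simp [val, mul_smul]
      rw [ev] at hyc ⊢
      refine ih l₀ (by simpa using hl) ⟨fun r hr' => hr.1 r (by simp [hr']), ?_⟩ a ha b hb c hc hcM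
        p (q.2 • y) hp ?_ hpc hyc
      · exact (List.isChain_append.1 hr.2).1
      · exact X.Ainv (by rw [← hs.zpowers]; exact hqr.2.1) hy
    rcases l with _ | ⟨⟨g, t⟩, l⟩
    · simp at hl
    have hp1 := hr.1 (g, t) (by simp)
    simp only at hp1
    have hc1 := List.isChain_cons.1 hr.2
    have hr' : Red (layer 𝒢 A W M) l := ⟨fun q hq => hr.1 q (by simp [hq]), hc1.2⟩
    have ev : val ((g, t) :: l) • y = t • (val l • y) := by simp [val, mul_smul]
    rw [ev] at hyc ⊢
    by_cases hfirst : Same a g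
    · have htM : t⁻¹ ∈ bigM 𝒢 A W M := by
        have : t⁻¹ ∈ Subgroup.zpowers g := inv_mem hp1.2.1
        obtain ⟨k, hk⟩ := Subgroup.mem_zpowers_iff.1 this
        rw [← hk]
        exact zpow_mem (layer_le hp1.1) k
      have := ih l (by simpa using hl) hr' a ha b hb (t⁻¹ * c * t⁻¹⁻¹) (X.conj _ _ hc)
        (fun h => hcM (by
          have := mul_mem (mul_mem (inv_mem htM) h) htM
          convert this using 1
          group)) (t⁻¹ • p) y
        (X.Ainv (inv_mem (by rw [← hfirst.zpowers]; exact hp1.2.1)) hp) hy (X.Aconj _ _ _ hpc)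
        (by simpa using X.Aconj t⁻¹ _ _ hyc)
      rw [X.τconj, ← X.iso t] at this
      simpa using this
    · exfalso
      have n1 := X.near_of_axis hG hp1.1 ha (fun h => hfirst h.symm) hp
      have n2 : Near d lam A τ W g (val l • y) := by
        refine X.near_word hG hp1.1 l hr' hc1.1 ?_
        intro g' hg' k1 k2
        refine X.near_of_axis hG hg' hb (fun hs => hlast ?_) hy
        rcases l with _ | ⟨q, l⟩
        · exact ⟨(g, t), by simp, by rw [k2 rfl] at hs; exact hs.symm⟩
        · rw [List.getLast?_cons_cons]
          obtain ⟨r, hr⟩ : ∃ r, (q :: l).getLast? = some r := ⟨_, List.getLast?_eq_some_getLast (by simp)⟩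
          exact ⟨r, hr, by rw [← k1 r hr]; exact hs.symm⟩
      obtain ⟨q, b₁, hq, hb1W, hb1A, hqb⟩ := n1
      obtain ⟨q', b₂, hq', hb2W, hb2A, hqb'⟩ := n2
      have hf := X.far hG hp1.1 hp1.2.1 hp1.2.2 hb2W hb2A hqb' hb1W hb1A
      have hq'' := X.gate_smul hp1.2.1 hq'
      have ht : (d b₁ (t • q') : ℝ) ≤ d q b₁ + d q (t • q') := by
        rw [X.T.symm q b₁]
        exact_mod_cast X.T.tri b₁ q (t • q')
      have h6 := X.lam_six (g := g)
      have h0 := X.lam_pos hp1.1.1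
      have hne : q ≠ t • q' := by
        intro h
        rw [← h, X.T.symm b₁ q] at hf
        linarith
      have hg := X.T.gate_geo hq hq'' hne
      have hqc : q ∈ A c := X.conv c hc _ hpc _ hyc q (by
        have := X.T.tri q (t • q') (t • val l • y)
        have := X.T.tri p q (t • val l • y)
        omega)
      have hqc' : t • q' ∈ A c := X.conv c hc _ hpc _ hyc _ (by
        have := X.T.tri p q (t • q')
        have := X.T.tri p (t • q') (t • val l • y)
        omega)
      have := X.overlap_same hp1.1.1 hc (hns g hp1.1 c hcM) hq.1 hqc hq''.1 hqc'
      linarith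

theorem big_small (X : AxisFamily d lam 𝒢 A τ)
    (hG : Good d lam 𝒢 A τ K e W M) (c : F) (hc : c ∈ 𝒢)
    (hcM : c ∉ bigM 𝒢 A W M) (x y : V) (hx : x ∈ bigW 𝒢 A W M) (hxc : x ∈ A c)
    (hy : y ∈ bigW 𝒢 A W M) (hyc : y ∈ A c) : (d x y : ℝ) < 2 * lam * τ c := by
  have hcj : ∀ h ∈ bigM 𝒢 A W M, h * c * h⁻¹ ∉ bigM 𝒢 A W M := by
    intro h hh hm
    apply hcM
    have := mul_mem (mul_mem (inv_mem hh) hm) hh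
    convert this using 1
    group
  have hmem : ∀ x ∈ bigW 𝒢 A W M, x ∈ A c → ∃ h ∈ bigM 𝒢 A W M, ∃ g ∈ layer 𝒢 A W M,
      ∃ y ∈ A g, x = h • y := by
    rintro _ ⟨h, hh, y, rfl, hy⟩ hxc
    rcases hy with hy | ⟨g, hg, hy⟩
    · exfalso
      have : y ∈ A (h⁻¹ * c * h⁻¹⁻¹) := by simpa using X.Aconj h⁻¹ _ _ hxc
      exact X.axis_disj _ (X.conj _ _ hc) (hcj _ (inv_mem hh)) this hy
    · exact ⟨h, hh, g, hg, y, hy, rfl⟩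
  obtain ⟨h₁, hh1, a, ha, p, hp, rfl⟩ := hmem x hx hxc
  obtain ⟨h₂, hh2, b, hb, q, hq, rfl⟩ := hmem y hy hyc
  obtain ⟨l, hl, n, hn, e1⟩ := X.normal_form hG (mul_mem (inv_mem hh1) hh2)
  have e2 : val l • (n • q) = h₁⁻¹ • (h₂ • q) := by
    rw [← mul_smul, ← mul_smul, e1]
  have := X.big_small_word hG l.length l rfl hl a ha (n * b * n⁻¹) (X.layer_conj hG hb hn)
    (h₁⁻¹ * c * h₁⁻¹⁻¹) (X.conj _ _ hc) (hcj _ (inv_mem hh1)) p (n • q) hp (X.Aconj _ _ _ hq)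
    (by simpa using X.Aconj h₁⁻¹ _ _ hxc) (by rw [e2]; exact X.Aconj h₁⁻¹ _ _ hyc)
  rw [X.τconj, e2, ← X.iso h₁] at this
  simpa using this

theorem big_good (X : AxisFamily d lam 𝒢 A τ)
    (hG : Good d lam 𝒢 A τ K e W M)
    (hK : ∀ g ∈ 𝒢, K ≤ (τ g : ℝ) - 3 * (lam * τ g)) :
    Good d lam 𝒢 A τ K e (bigW 𝒢 A W M) (bigM 𝒢 A W M) where
  conv := X.big_conv hG
  base := W_le hG.base
  inv _ hn _ hx := big_inv hn hx
  disp _ hw h1 := X.big_disp hG hK hw h1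
  small c hc hcM x y hx hxc hy hyc := X.big_small hG c hc hcM x y hx hxc hy hyc

/-- Thickening. -/
theorem thick_good (X : AxisFamily d lam 𝒢 A τ)
    (hG : Good d lam 𝒢 A τ K e W M) (hlay : layer 𝒢 A W M = ∅) :
    Good d lam 𝒢 A τ K e {x | ∃ w ∈ W, d w x ≤ 1} M where
  conv := by
    rintro x ⟨u, hu, hux⟩ y ⟨v, hv, hvy⟩ z hz
    have hone : ∀ w ∈ W, ∀ x, d w x ≤ 1 → d w x = d w z + d z x → ∃ w ∈ W, d w z ≤ 1 := by
      intro w hw x h1 h2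
      exact ⟨w, hw, by omega⟩
    rcases X.T.split u hz with h | h
    · exact hone u hu x hux (by have := X.T.symm u x; have := X.T.symm u z; have := X.T.symm z x; omega)
    · rcases X.T.split v h with h | h
      · exact ⟨z, hG.conv u hu v hv z h, by simp [X.T.self]⟩
      · exact hone v hv y hvy h
  base := ⟨e, hG.base, by simp [X.T.self]⟩
  inv := by
    rintro n hn x ⟨w, hw, h⟩
    exact ⟨n • w, hG.inv n hn w hw, by rwa [X.iso]⟩
  disp := hG.disp
  small := by
    rintro g hg hgM x y ⟨u, hu, hux⟩ hxA ⟨v, hv, hvy⟩ hyA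
    have hdis : ∀ z ∈ W, z ∉ A g := fun z hz hzA => by
      have : g ∈ layer 𝒢 A W M := ⟨hg, hgM, z, hz, hzA⟩
      rw [hlay] at this
      exact this
    have hxy : x = y := by
      obtain ⟨p, hp⟩ := X.T.exists_gate hG.conv ⟨e, hG.base⟩ x
      obtain ⟨q, hq⟩ := X.T.exists_gate hG.conv ⟨e, hG.base⟩ y
      have hpx : d x p ≤ 1 := by have := hp.2 u hu; have := X.T.symm x u; omega
      have hqy : d y q ≤ 1 := by have := hq.2 v hv; have := X.T.symm y v; omega
      have hpg : ¬ d x y = d x p + d p y := fun h => hdis p hp.1 (X.conv g hg x hxA y hyA p h)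
      by_cases hpq : p = q
      · subst hpq
        have h0 : d x p ≠ 0 := fun h => hdis p hp.1 (by rw [← X.T.eq_of _ _ h]; exact hxA)
        have e1 := X.T.symm x p
        have e2 := X.T.symm y p
        have e3 := X.T.symm y x
        rcases X.T.tree p x x y (by omega) (by rw [X.T.self]; omega) with h | h
        · exact X.T.eq_of _ _ (by omega)
        · exact absurd h hpg
      · have h1 := X.T.gate_geo hp hq hpq
        have h2 := hq.2 p hp.1
        have e1 := X.T.symm y p
        have e2 := X.T.symm y q
        have e3 := X.T.symm q p
        exact absurd (by omega) hpg
    subst hxy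
    have := X.lam_pos hg
    rw [X.T.self]
    push_cast
    linarith

theorem main (X : AxisFamily d lam 𝒢 A τ)
    (e : V) (hK : ∀ g ∈ 𝒢, K ≤ (τ g : ℝ) - 3 * (lam * τ g)) {w : F}
    (hw : w ∈ Subgroup.closure 𝒢) (h1 : w ≠ 1) : K < d e (w • e) := by
  let S : Set (Set V × Subgroup F) := {P | Good d lam 𝒢 A τ K e P.1 P.2}
  have h0 : (({e}, ⊥) : Set V × Subgroup F) ∈ S := by
    refine ⟨?_, rfl, ?_, ?_, ?_⟩
    · intro x hx y hy z hz
      simp only [Set.mem_singleton_iff] at hx hy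
      subst hx; subst hy
      rw [X.T.self] at hz
      exact (X.T.eq_of _ _ (by omega)).symm
    · intro n hn x hx
      simp only [Subgroup.mem_bot, Set.mem_singleton_iff] at hn hx
      subst hn; subst hx
      simp
    · intro w hw h
      exact absurd (Subgroup.mem_bot.1 hw) h
    · intro g hg _ x y hx _ hy _
      simp only [Set.mem_singleton_iff] at hx hy
      subst hx; subst hy
      rw [X.T.self]
      have := X.lam_pos hg
      push_cast
      linarith
  obtain ⟨P, hP0, hP⟩ := zorn_le_nonempty₀ S (by
    intro c hcS hc y hy
    have hdir : ∀ P ∈ c, ∀ Q ∈ c, ∃ R ∈ c, P ≤ R ∧ Q ≤ R := by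
      intro P hP Q hQ
      rcases hc.total hP hQ with h | h
      · exact ⟨Q, hQ, h, le_rfl⟩
      · exact ⟨P, hP, le_rfl, h⟩
    have hdirS : DirectedOn (· ≤ ·) (Prod.snd '' c) := by
      rintro _ ⟨P, hP, rfl⟩ _ ⟨Q, hQ, rfl⟩
      obtain ⟨R, hR, h1, h2⟩ := hdir P hP Q hQ
      exact ⟨R.2, ⟨R, hR, rfl⟩, h1.2, h2.2⟩
    have hmem : ∀ g, g ∈ sSup (Prod.snd '' c) ↔ ∃ P ∈ c, g ∈ P.2 := by
      intro g
      rw [Subgroup.mem_sSup_of_directedOn (Set.Nonempty.image Prod.snd ⟨y, hy⟩) hdirS]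
      simp only [Set.exists_mem_image]
    refine ⟨(⋃ P ∈ c, P.1, sSup (Prod.snd '' c)), ⟨?_, ?_, ?_, ?_, ?_⟩, ?_⟩
    · intro x hx y hy z hz
      simp only [Set.mem_iUnion, exists_prop] at hx hy ⊢
      obtain ⟨P, hP, hx⟩ := hx
      obtain ⟨Q, hQ, hy⟩ := hy
      obtain ⟨R, hR, h1, h2⟩ := hdir P hP Q hQ
      exact ⟨R, hR, (hcS hR).conv x (h1.1 hx) y (h2.1 hy) z hz⟩
    · simp only [Set.mem_iUnion, exists_prop]
      exact ⟨y, hy, (hcS hy).base⟩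
    · intro n hn x hx
      simp only [Set.mem_iUnion, exists_prop] at hx ⊢
      rw [hmem] at hn
      obtain ⟨P, hP, hx⟩ := hx
      obtain ⟨Q, hQ, hn⟩ := hn
      obtain ⟨R, hR, h1, h2⟩ := hdir P hP Q hQ
      exact ⟨R, hR, (hcS hR).inv n (h2.2 hn) x (h1.1 hx)⟩
    · intro w hw h
      rw [hmem] at hw
      obtain ⟨P, hP, hw⟩ := hw
      exact (hcS hP).disp w hw h
    · intro g hg hgM x y hx hxA hy hyA
      simp only [Set.mem_iUnion, exists_prop] at hx hy
      rw [hmem] at hgM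
      obtain ⟨P, hP, hx⟩ := hx
      obtain ⟨Q, hQ, hy⟩ := hy
      obtain ⟨R, hR, h1, h2⟩ := hdir P hP Q hQ
      exact (hcS hR).small g hg (fun h => hgM ⟨R, hR, h⟩) x y (h1.1 hx) hxA (h2.1 hy) hyA
    · intro P hP
      exact ⟨fun x hx => Set.mem_biUnion hP hx, le_sSup (Set.mem_image_of_mem _ hP)⟩) _ h0
  obtain ⟨W, M⟩ := P
  have hG : Good d lam 𝒢 A τ K e W M := hP.1
  have hlay : layer 𝒢 A W M = ∅ := by
    by_contra hne
    obtain ⟨g, hg⟩ := Set.nonempty_iff_ne_empty.2 hne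
    have := hP.2 (y := (bigW 𝒢 A W M, bigM 𝒢 A W M)) (X.big_good hG hK) ⟨W_le, M_le⟩
    exact hg.2.1 (this.2 (layer_le hg))
  have hthick := hP.2 (y := ({x | ∃ w ∈ W, d w x ≤ 1}, M)) (X.thick_good hG hlay)
    ⟨fun x hx => ⟨x, hx, by simp [X.T.self]⟩, le_rfl⟩
  have hall : ∀ n x, d e x = n → x ∈ W := by
    intro n
    induction n with
    | zero => intro x hx; rw [← X.T.eq_of _ _ hx]; exact hG.base
    | succ n ih =>
      intro x hx
      obtain ⟨x', h1, h2⟩ := X.T.nb x e (by rw [X.T.symm]; omega)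
      have := ih x' (by rw [X.T.symm x' e, X.T.symm x e] at h2; omega)
      exact hthick.1 ⟨x', this, by rw [X.T.symm]; omega⟩
  have hle : Subgroup.closure 𝒢 ≤ M := by
    rw [Subgroup.closure_le]
    intro g hg
    by_contra hgM
    obtain ⟨x, hx⟩ := X.ne g hg
    have : g ∈ layer 𝒢 A W M := ⟨hg, hgM, x, hall _ x rfl, hx⟩
    rw [hlay] at this
    exact this
  exact hG.disp w (hle hw) h1

end AxisFamily
end AmalgamFormalization

namespace AmalgamFormalization

/-! ### Graph trees give tree metrics -/

theorem treeDist_of_isTree {V : Type*} {Γ : SimpleGraph V} (h : Γ.IsTree) :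
    TreeDist (fun x y => Γ.dist x y) where
  self x := SimpleGraph.dist_self
  eq_of x y hxy := h.connected.dist_eq_zero_iff.1 hxy
  symm x y := SimpleGraph.dist_comm
  tri x y z := h.connected.dist_triangle
  nb x y hxy := by
    obtain ⟨p, hp⟩ := h.connected.exists_walk_length_eq_dist x y
    cases p with
    | nil => simp at hxy
    | cons ha p =>
      rename_i x'
      refine ⟨x', SimpleGraph.dist_eq_one_iff_adj.2 ha, ?_⟩
      have h1 := SimpleGraph.dist_le p
      have h2 := h.connected.dist_triangle (u := x) (v := x') (w := y)
      have h3 := SimpleGraph.dist_eq_one_iff_adj.2 ha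
      simp only [SimpleGraph.Walk.length_cons] at hp
      omega
  tree m x' x y h1 h2 := by
    have ha := SimpleGraph.dist_eq_one_iff_adj.1 h1
    have tri := fun u v w => h.connected.dist_triangle (u := u) (v := v) (w := w)
    have cm := fun u v => SimpleGraph.dist_comm (G := Γ) (u := u) (v := v)
    rcases h.dist_eq_dist_add_one_of_adj y ha with h3 | h3
    · left; rw [cm m y, cm x' y]; exact h3
    right
    obtain ⟨P, hP⟩ := h.connected.exists_walk_length_eq_dist x x'
    obtain ⟨Q, hQ⟩ := h.connected.exists_walk_length_eq_dist m y
    have hPp := P.isPath_of_length_eq_dist hP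
    have hQp := Q.isPath_of_length_eq_dist hQ
    have hpath : (P.append (SimpleGraph.Walk.cons ha.symm Q)).IsPath := by
      rw [SimpleGraph.Walk.isPath_def, SimpleGraph.Walk.support_append,
        SimpleGraph.Walk.support_cons, List.tail_cons]
      refine List.Nodup.append hPp.support_nodup hQp.support_nodup ?_
      intro z hz1 hz2
      obtain ⟨q, r, -, -, e1⟩ := hPp.mem_support_iff_exists_append.1 hz1
      obtain ⟨q', r', -, -, e2⟩ := hQp.mem_support_iff_exists_append.1 hz2
      have l1 := congrArg SimpleGraph.Walk.length e1
      have l2 := congrArg SimpleGraph.Walk.length e2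
      rw [SimpleGraph.Walk.length_append] at l1 l2
      have a1 := SimpleGraph.dist_le q
      have a2 := SimpleGraph.dist_le r
      have a3 := SimpleGraph.dist_le q'
      have a4 := SimpleGraph.dist_le r'
      have c1 := cm z m
      have c2 := cm z x'
      have c3 := cm z x
      have c4 := cm x x'
      have c5 := cm y m
      have c6 := cm y x'
      rcases h.dist_eq_dist_add_one_of_adj z ha with h4 | h4
      · have := tri x' z y
        omega
      · have := tri m z x
        omega
    obtain ⟨S, hS, hSl⟩ := h.connected.exists_path_of_dist x y
    have hu := (h.existsUnique_path x y).unique hpath hS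
    have hl := congrArg SimpleGraph.Walk.length hu
    rw [SimpleGraph.Walk.length_append, SimpleGraph.Walk.length_cons] at hl
    have c4 := cm x x'
    have c5 := cm x m
    omega

/-! ### Minimal displacement sets -/

section MinSet

variable {V : Type*} {F : Type*} [Group F] [MulAction F V]

/-- translation length -/
noncomputable def tau (d : V → V → ℕ) (g : F) : ℕ := sInf {n | ∃ z, d z (g • z) = n}

/-- minimal displacement set -/
def Ax (d : V → V → ℕ) (g : F) : Set V := {y | d y (g • y) = tau d g}

variable {d : V → V → ℕ}

theorem tau_le (g : F) (z : V) : tau d g ≤ d z (g • z) := Nat.sInf_le ⟨z, rfl⟩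

theorem Ax_ne [Nonempty V] (g : F) : (Ax d g).Nonempty := by
  obtain ⟨z⟩ := ‹Nonempty V›
  exact Nat.sInf_mem (s := {n | ∃ z, d z (g • z) = n}) ⟨_, z, rfl⟩

theorem disp_conj (iso : ∀ (g : F) x y, d (g • x) (g • y) = d x y) (c g : F) (z : V) :
    d (c • z) ((c * g * c⁻¹) • (c • z)) = d z (g • z) := by
  rw [← iso c z]
  simp [mul_smul]

theorem tau_conj (iso : ∀ (g : F) x y, d (g • x) (g • y) = d x y) (c g : F) :
    tau d (c * g * c⁻¹) = tau d g := by
  unfold tau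
  congr 1
  ext n
  constructor
  · rintro ⟨z, rfl⟩
    refine ⟨c⁻¹ • z, ?_⟩
    rw [← disp_conj iso c g]
    simp
  · rintro ⟨z, rfl⟩
    exact ⟨c • z, disp_conj iso c g z⟩

theorem Ax_conj (iso : ∀ (g : F) x y, d (g • x) (g • y) = d x y) (c g : F) (x : V)
    (hx : x ∈ Ax d g) : c • x ∈ Ax d (c * g * c⁻¹) := by
  unfold Ax at *
  simp only [Set.mem_ofPred_eq] at *
  rw [tau_conj iso, disp_conj iso, hx]

theorem disp_inv (T : TreeDist d) (iso : ∀ (g : F) x y, d (g • x) (g • y) = d x y) (g : F)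
    (z : V) : d z (g⁻¹ • z) = d z (g • z) := by
  rw [← iso g z, T.symm]
  simp

theorem tau_inv (T : TreeDist d) (iso : ∀ (g : F) x y, d (g • x) (g • y) = d x y) (g : F) :
    tau d g⁻¹ = tau d g := by
  unfold tau
  simp only [disp_inv T iso]

theorem Ax_inv (T : TreeDist d) (iso : ∀ (g : F) x y, d (g • x) (g • y) = d x y) (g : F) :
    Ax d g⁻¹ = Ax d g := by
  unfold Ax
  simp only [disp_inv T iso, tau_inv T iso]

theorem Ax_conv (T : TreeDist d) (iso : ∀ (g : F) x y, d (g • x) (g • y) = d x y) (g : F) :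
    TreeDist.Conv d (Ax d g) := by
  intro y hy z hz x hx
  unfold Ax at *
  simp only [Set.mem_ofPred_eq] at *
  have h0 := tau_le (d := d) g x
  have i1 := iso g y x
  have i2 := iso g x z
  have s1 := T.symm z (g • z)
  rcases T.split (g • x) hx with h | h
  · have := T.tri y (g • y) (g • x)
    omega
  · have := T.tri (g • x) (g • z) z
    have := T.symm (g • x) x
    omega

theorem Ax_two (T : TreeDist d) (iso : ∀ (g : F) x y, d (g • x) (g • y) = d x y) {g : F}
    (h2 : 2 ≤ tau d g) {y : V} (hy : y ∈ Ax d g) :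
    d y (g • g • y) = tau d g + tau d g := by
  have hy' : d y (g • y) = tau d g := hy
  have i1 : d (g • y) (g • g • y) = tau d g := by rw [iso]; exact hy
  have s0 := T.symm y (g • y)
  obtain ⟨m', a1, a2⟩ := T.nb (g • y) y (by omega)
  rcases T.tree _ m' y (g • g • y) a1 a2 with h | h
  · exfalso
    have i2 := iso g m' y
    have i3 := iso g (g • y) m'
    have s1 := T.symm (g • m') (g • y)
    rcases T.tree _ m' _ (g • m') a1 h with h3 | h3
    · have := tau_le (d := d) g m'
      omega
    · have s2 := T.symm (g • g • y) (g • y)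
      omega
  · omega

theorem Ax_mem_smul (iso : ∀ (g : F) x y, d (g • x) (g • y) = d x y) {g : F} {y : V}
    (hy : y ∈ Ax d g) : g • y ∈ Ax d g := by
  have := Ax_conj iso g g y hy
  simpa using this

theorem Ax_pow (T : TreeDist d) (iso : ∀ (g : F) x y, d (g • x) (g • y) = d x y) {g : F}
    (h2 : 2 ≤ tau d g) {y : V} (hy : y ∈ Ax d g) (n : ℕ) :
    d y (g ^ (n + 1) • y) = d y (g ^ n • y) + tau d g := by
  induction n with
  | zero => simp [T.self]; exact hy
  | succ n ih =>
    have e1 : g ^ (n + 1) • y = g ^ n • (g • y) := by rw [pow_succ, mul_smul]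
    have e2 : g ^ (n + 1 + 1) • y = g ^ n • (g • g • y) := by
      rw [pow_succ, pow_succ, mul_smul, mul_smul]
    have i1 := iso (g ^ n) y (g • y)
    have i2 := iso (g ^ n) y (g • g • y)
    have i3 := iso (g ^ n) (g • y) (g • g • y)
    have i4 := iso g y (g • y)
    have h := Ax_two T iso h2 hy
    have hy' : d y (g • y) = tau d g := hy
    rw [e1] at ih
    rw [e2, e1]
    rcases T.split (x := g ^ n • g • y) (y := g ^ n • y) (z := g ^ n • g • g • y) y
      (by omega) with k | k
    · have := T.symm (g ^ n • y) y
      have := T.symm (g ^ n • g • y) y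
      omega
    · omega

theorem Ax_disp (T : TreeDist d) (iso : ∀ (g : F) x y, d (g • x) (g • y) = d x y) {g : F}
    (h2 : 2 ≤ tau d g) {t : F} (ht : t ∈ Subgroup.zpowers g) (h1 : t ≠ 1) {y : V}
    (hy : y ∈ Ax d g) : tau d g ≤ d y (t • y) := by
  obtain ⟨n, rfl⟩ := ht
  have key : ∀ k : ℕ, k ≠ 0 → tau d g ≤ d y (g ^ k • y) := by
    intro k hk
    obtain ⟨m, rfl⟩ := Nat.exists_eq_succ_of_ne_zero hk
    have := Ax_pow T iso h2 hy m
    simp only [Nat.succ_eq_add_one]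
    omega
  simp only at h1 ⊢
  obtain ⟨k, rfl | rfl⟩ := n.eq_nat_or_neg
  · rw [zpow_natCast] at *
    exact key k (by rintro rfl; simp at h1)
  · rw [zpow_neg, zpow_natCast] at *
    rw [disp_inv T iso]
    exact key k (by rintro rfl; simp at h1)

/-- The axis is a line: a nearby point of `Ax g` lies on the way to `g u` or `g⁻¹ u`. -/
theorem Ax_line_aux (T : TreeDist d) (iso : ∀ (g : F) x y, d (g • x) (g • y) = d x y) {g : F}
    {u v : V} (hu : u ∈ Ax d g) (hv : v ∈ Ax d g) (huv : d u v ≤ tau d g)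
    (h : d u (g • v) = tau d g + d u v) : d u (g • u) = d u v + d v (g • u) := by
  have hu' : d u (g • u) = tau d g := hu
  have hv' : d v (g • v) = tau d g := hv
  obtain ⟨m, h1, h2, h3⟩ := T.median u v (g • u)
  by_cases hb : d m v = 0
  · have := T.eq_of _ _ hb
    subst this
    exact h2
  have i1 := iso g u v
  have s0 := T.symm v m
  have s1 := T.symm (g • v) (g • u)
  have t1 := T.tri u m (g • v)
  have t2 := T.tri m (g • u) (g • v)
  have s2 := T.symm (g • v) m
  rcases T.split (g • v) h3 with k | k
  · omega
  · omega

theorem Ax_line (T : TreeDist d) (iso : ∀ (g : F) x y, d (g • x) (g • y) = d x y) {g : F}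
    (h2 : 2 ≤ tau d g) {u v : V} (hu : u ∈ Ax d g) (hv : v ∈ Ax d g) (huv : d u v ≤ tau d g) :
    d u (g • u) = d u v + d v (g • u) ∨ d u (g⁻¹ • u) = d u v + d v (g⁻¹ • u) := by
  have hu' : d u (g • u) = tau d g := hu
  have h := Ax_two T iso h2 hu
  have i1 := iso g u (g • u)
  rcases T.split (g • v) (x := g • u) (y := u) (z := g • g • u) (by omega) with k | k
  · left
    refine Ax_line_aux T iso hu hv huv ?_
    have := iso g u v
    omega
  · right
    have hi := Ax_inv T iso g
    have hj := tau_inv T iso g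
    refine Ax_line_aux T iso (hi ▸ hu) (hi ▸ hv) (hj ▸ huv) ?_
    rw [T.symm, ← iso g]
    have i2 := iso g v (g • u)
    have i3 := iso g v u
    have s := T.symm u v
    simp only [smul_inv_smul]
    have i4 := iso g v (g • u)
    omega

theorem point_at (T : TreeDist d) (x y : V) (k : ℕ) (hk : k ≤ d x y) :
    ∃ z, d x z = k ∧ d x y = d x z + d z y := by
  induction k with
  | zero => exact ⟨x, by simp [T.self]⟩
  | succ k ih =>
    obtain ⟨z, h1, h2⟩ := ih (by omega)
    obtain ⟨z', h3, h4⟩ := T.nb z y (by omega)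
    have := T.tri x z z'
    have := T.tri x z' y
    exact ⟨z', by omega, by omega⟩

end MinSet
end AmalgamFormalization

namespace AmalgamFormalization

section Words

variable {F : Type*} [Group F]

/-- The two factors, indexed by `Bool`. -/
def fac (L G : Subgroup F) (b : Bool) : Subgroup F := if b then L else G

variable {L G : Subgroup F}

theorem sameFactor_iff {u v : F} : SameFactor L G u v ↔ ∃ b, u ∈ fac L G b ∧ v ∈ fac L G b := by
  simp [SameFactor, fac, or_comm]

theorem mem_union_iff {u : F} : u ∈ (L : Set F) ∪ (G : Set F) ↔ ∃ b, u ∈ fac L G b := by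
  simp [fac, or_comm]

theorem mem_inf_iff {u : F} : u ∈ L ⊓ G ↔ ∀ b, u ∈ fac L G b := by
  simp [fac, Subgroup.mem_inf, and_comm]

/-- all letters in the factors -/
def Lett (L G : Subgroup F) (w : List F) : Prop := ∀ x ∈ w, ∃ b, x ∈ fac L G b

theorem canon_iff {w : List F} : IsCanonicalWord L G w ↔
    Lett L G w ∧ w.IsChain (fun a b => ¬ SameFactor L G a b) := by
  unfold IsCanonicalWord Lett
  simp only [mem_union_iff]
  rfl

theorem canon_cons {x : F} {w : List F} : IsCanonicalWord L G (x :: w) ↔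
    (∃ b, x ∈ fac L G b) ∧ (∀ y ∈ w.head?, ¬ SameFactor L G x y) ∧ IsCanonicalWord L G w := by
  rw [canon_iff, canon_iff, List.isChain_cons]
  simp only [Lett, List.forall_mem_cons]
  tauto

theorem canon_nil : IsCanonicalWord L G ([] : List F) := by
  rw [canon_iff]
  simp [Lett]

theorem not_same {b : Bool} {x y : F} (h1 : x ∉ fac L G (!b)) (h2 : y ∉ fac L G b) :
    ¬ SameFactor L G x y := by
  rw [sameFactor_iff]
  rintro ⟨c, h3, h4⟩
  cases b <;> cases c <;> simp_all

/-- Products of `n` letters have a canonical representation of length at most `n`. -/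
theorem exists_canon (n : ℕ) : ∀ w : List F, w.length = n → Lett L G w →
    ∃ w', IsCanonicalRep L G w.prod w' ∧ w'.length ≤ n := by
  induction n using Nat.strong_induction_on with
  | _ n ih =>
    intro w hw hl
    rcases w with _ | ⟨x, w⟩
    · exact ⟨[], ⟨canon_nil, rfl⟩, by simp⟩
    · simp only [List.length_cons] at hw
      obtain ⟨w', ⟨hc, hp⟩, hlen⟩ := ih w.length (by omega) w rfl (fun y hy => hl y (by simp [hy]))
      have hx := hl x (by simp)
      rcases w' with _ | ⟨u, w'⟩
      · refine ⟨[x], ⟨canon_cons.2 ⟨hx, by simp, canon_nil⟩, ?_⟩, by simp; omega⟩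
        simp [← hp]
      · by_cases hs : SameFactor L G x u
        · obtain ⟨b, h1, h2⟩ := sameFactor_iff.1 hs
          have hc' := canon_cons.1 hc
          simp only [List.length_cons] at hlen
          obtain ⟨w2, h3, h4⟩ := ih (w'.length + 1) (by omega) ((x * u) :: w') (by simp) (by
            intro y hy
            rcases List.mem_cons.1 hy with rfl | hy
            · exact ⟨b, mul_mem h1 h2⟩
            · exact (canon_iff.1 hc).1 y (by simp [hy]))
          refine ⟨w2, ?_, by omega⟩
          have : ((x * u) :: w').prod = (x :: w).prod := by
            simp [← hp, mul_assoc]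
          rwa [this] at h3
        · refine ⟨x :: u :: w', ⟨canon_cons.2 ⟨hx, by simpa using hs, hc⟩, ?_⟩, ?_⟩
          · simp only [List.prod_cons] at hp ⊢
            rw [hp]
          · simp only [List.length_cons] at hlen ⊢
            omega

theorem len_le_of_word {w : List F} (hl : Lett L G w) : len L G w.prod ≤ w.length := by
  obtain ⟨w', h1, h2⟩ := exists_canon _ w rfl hl
  exact le_trans (Nat.sInf_le (show w'.length ∈ {n | ∃ w'' : List F,
    IsCanonicalRep L G w.prod w'' ∧ w''.length = n} from ⟨w', h1, rfl⟩)) h2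

theorem exists_word (hF : IsAmalgam L G) (x : F) : ∃ w : List F, Lett L G w ∧ w.prod = x := by
  have hx : x ∈ Subgroup.closure ((L : Set F) ∪ (G : Set F)) := by
    rw [Subgroup.closure_union, Subgroup.closure_eq, Subgroup.closure_eq, hF.1]
    trivial
  induction hx using Subgroup.closure_induction_left with
  | one => exact ⟨[], by simp [Lett], rfl⟩
  | mul_left s hs y hy ih =>
    obtain ⟨w, h1, h2⟩ := ih
    exact ⟨s :: w, List.forall_mem_cons.2 ⟨mem_union_iff.1 hs, h1⟩, by simp [h2]⟩
  | inv_mul_cancel s hs y hy ih =>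
    obtain ⟨w, h1, h2⟩ := ih
    obtain ⟨b, hb⟩ := mem_union_iff.1 hs
    exact ⟨s⁻¹ :: w, List.forall_mem_cons.2 ⟨⟨b, inv_mem hb⟩, h1⟩, by simp [h2]⟩

theorem exists_len (hF : IsAmalgam L G) (x : F) :
    ∃ w : List F, IsCanonicalRep L G x w ∧ w.length = len L G x := by
  obtain ⟨w, h1, rfl⟩ := exists_word hF x
  obtain ⟨w', h2, h3⟩ := exists_canon _ w rfl h1
  exact Nat.sInf_mem (s := {n | ∃ w' : List F, IsCanonicalRep L G w.prod w' ∧ w'.length = n})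
    ⟨_, w', h2, rfl⟩

theorem len_mul_le (hF : IsAmalgam L G) (x y : F) : len L G (x * y) ≤ len L G x + len L G y := by
  obtain ⟨w, ⟨h1, rfl⟩, h2⟩ := exists_len hF x
  obtain ⟨w', ⟨h3, rfl⟩, h4⟩ := exists_len hF y
  rw [← List.prod_append, ← h2, ← h4, ← List.length_append]
  refine len_le_of_word ?_
  intro z hz
  rcases List.mem_append.1 hz with hz | hz
  · exact (canon_iff.1 h1).1 z hz
  · exact (canon_iff.1 h3).1 z hz

/-- A canonical word of length at least two does not represent an element of a factor. -/
theorem canon_not_mem (hF : IsAmalgam L G) {w : List F} (hw : IsCanonicalWord L G w)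
    (h2 : 2 ≤ w.length) (b : Bool) : w.prod ∉ fac L G b := by
  intro hl
  rcases w with _ | ⟨x, _ | ⟨u, w⟩⟩
  · simp at h2
  · simp at h2
  obtain ⟨⟨c, hx⟩, hxu, hw'⟩ := canon_cons.1 hw
  have hxu : ¬ SameFactor L G x u := hxu u (by simp)
  obtain ⟨⟨e, hu⟩, huw, hw''⟩ := canon_cons.1 hw'
  set l := (x :: u :: w).prod with hldef
  have hpr : l = x * (u * w.prod) := by simp [hldef]
  by_cases hs : SameFactor L G l x
  · obtain ⟨c, hlc, hxc⟩ := sameFactor_iff.1 hs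
    have huc : u ∉ fac L G c := fun h => hxu (sameFactor_iff.2 ⟨c, hxc, h⟩)
    have hue : u ∈ fac L G (!c) := by
      rcases Bool.eq_or_eq_not e c with rfl | rfl
      · exact absurd hu huc
      · exact hu
    have hk : l⁻¹ * x ∈ fac L G c := mul_mem (inv_mem hlc) hxc
    by_cases hk' : l⁻¹ * x ∈ fac L G (!c)
    · have hnew : l⁻¹ * x * u ∈ fac L G (!c) := mul_mem hk' hue
      rcases w with _ | ⟨v, w⟩
      · have : u = (l⁻¹ * x)⁻¹ := by
          rw [hpr]; simp
        exact huc (this ▸ inv_mem hk)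
      · have hvs := huw v (by simp)
        refine hF.2 ((l⁻¹ * x * u) :: v :: w) (canon_cons.2 ⟨⟨_, hnew⟩, ?_, hw''⟩) (by simp) ?_
        · intro y hy
          simp only [List.head?_cons, Option.mem_def, Option.some.injEq] at hy
          subst hy
          refine not_same (b := !c) ?_ (fun h => hvs (sameFactor_iff.2 ⟨_, hue, h⟩))
          rw [Bool.not_not]
          intro h
          exact huc ((Subgroup.mul_mem_cancel_left _ hk).1 h)
        · rw [hpr]; simp [mul_assoc]
    · refine hF.2 ((l⁻¹ * x) :: u :: w) (canon_cons.2 ⟨⟨_, hk⟩, ?_, hw'⟩) (by simp) ?_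
      · intro y hy
        simp only [List.head?_cons, Option.mem_def, Option.some.injEq] at hy
        subst hy
        exact not_same hk' huc
      · rw [hpr]; simp [mul_assoc]
  · refine hF.2 (l⁻¹ :: x :: u :: w) (canon_cons.2 ⟨⟨b, inv_mem hl⟩, ?_, hw⟩) (by simp) ?_
    · intro y hy
      simp only [List.head?_cons, Option.mem_def, Option.some.injEq] at hy
      subst hy
      intro h
      obtain ⟨c, h1, h2⟩ := sameFactor_iff.1 h
      exact hs (sameFactor_iff.2 ⟨c, inv_mem_iff.1 h1, h2⟩)
    · rw [List.prod_cons, ← hldef]; simp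

/-! ### The Bass–Serre tree -/

/-- vertices of the Bass–Serre tree -/
abbrev BV (L G : Subgroup F) : Type _ := Σ b : Bool, F ⧸ fac L G b

/-- the vertex `x K_b` -/
def vt (L G : Subgroup F) (b : Bool) (x : F) : BV L G := ⟨b, (x : F ⧸ fac L G b)⟩

theorem vt_eq {b c : Bool} {x y : F} :
    vt L G b x = vt L G c y ↔ b = c ∧ x⁻¹ * y ∈ fac L G b := by
  unfold vt
  constructor
  · intro h
    obtain ⟨rfl, h⟩ := Sigma.mk.inj_iff.1 h
    exact ⟨rfl, QuotientGroup.eq.1 (eq_of_heq h)⟩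
  · rintro ⟨rfl, h⟩
    rw [QuotientGroup.eq.2 h]

theorem vt_surj (v : BV L G) : ∃ b x, v = vt L G b x := by
  obtain ⟨b, q⟩ := v
  obtain ⟨x, rfl⟩ := QuotientGroup.mk_surjective q
  exact ⟨b, x, rfl⟩

theorem vt_smul (g : F) (b : Bool) (x : F) : g • vt L G b x = vt L G b (g * x) := rfl

/-- the Bass–Serre tree -/
def BT (L G : Subgroup F) : SimpleGraph (BV L G) where
  Adj u v := ∃ x b, u = vt L G b x ∧ v = vt L G (!b) x
  symm := ⟨by
    rintro u v ⟨x, b, rfl, rfl⟩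
    exact ⟨x, !b, rfl, by simp⟩⟩
  loopless := ⟨by
    rintro u ⟨x, b, rfl, h⟩
    have := (vt_eq.1 h).1
    cases b <;> simp at this⟩

theorem BT_adj {u v : BV L G} : (BT L G).Adj u v ↔ ∃ x b, u = vt L G b x ∧ v = vt L G (!b) x :=
  Iff.rfl

/-- A word gives a walk. -/
theorem word_walk (w : List F) (hw : Lett L G w) : ∀ (u v : BV L G) (b c : Bool) (y : F),
    u = vt L G b y → v = vt L G c (y * w.prod) →
    ∃ p : (BT L G).Walk u v, p.length ≤ w.length + 1 ∧
      (∀ x ∈ w.head?, x ∈ fac L G b → p.length ≤ w.length) := by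
  induction w with
  | nil =>
    intro u v b c y hu hv
    rw [List.prod_nil, mul_one] at hv
    rcases Bool.eq_or_eq_not c b with rfl | rfl
    · subst hu
      subst hv
      exact ⟨SimpleGraph.Walk.nil, by simp, by simp⟩
    · exact ⟨SimpleGraph.Walk.cons (BT_adj.2 ⟨y, b, hu, hv⟩) SimpleGraph.Walk.nil,
        by simp, by simp⟩
  | cons k w ih =>
    intro u v b c y hu hv
    have hw' := List.forall_mem_cons.1 hw
    obtain ⟨e, he⟩ := hw'.1
    have ih := ih hw'.2
    have e2 : y * (k :: w).prod = y * k * w.prod := by simp [mul_assoc]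
    rw [e2] at hv
    by_cases hb : k ∈ fac L G b
    · have e1 : vt L G b y = vt L G b (y * k) := vt_eq.2 ⟨rfl, by simpa using hb⟩
      obtain ⟨p, hp, -⟩ := ih u v b c (y * k) (hu.trans e1) hv
      refine ⟨p, ?_, ?_⟩
      · simp only [List.length_cons]; omega
      · intro _ _ _; simp only [List.length_cons]; omega
    · have hbe : e = !b := by
        rcases Bool.eq_or_eq_not e b with rfl | rfl
        · exact absurd he hb
        · rfl
      subst hbe
      have e1 : vt L G (!b) y = vt L G (!b) (y * k) := vt_eq.2 ⟨rfl, by simpa using he⟩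
      obtain ⟨p, hp, -⟩ := ih _ v (!b) c (y * k) e1 hv
      refine ⟨SimpleGraph.Walk.cons (BT_adj.2 ⟨y, b, hu, rfl⟩) p, ?_, ?_⟩
      · simp only [List.length_cons, SimpleGraph.Walk.length_cons]; omega
      · intro x hx hxb
        simp only [List.head?_cons, Option.mem_def, Option.some.injEq] at hx
        subst hx
        exact absurd hxb hb

/-- A walk gives a word. -/
theorem walk_word {u v : BV L G} (p : (BT L G).Walk u v) : ∀ (b c : Bool) (y z : F),
    u = vt L G b y → v = vt L G c z →
    ∃ w : List F, Lett L G w ∧ w.length = p.length + 1 ∧ w.prod = y⁻¹ * z := by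
  induction p with
  | nil =>
    rintro b c y z rfl h
    obtain ⟨rfl, h'⟩ := vt_eq.1 h
    exact ⟨[y⁻¹ * z], fun x hx => ⟨b, by rw [List.mem_singleton.1 hx]; exact h'⟩,
      by simp, by simp⟩
  | cons ha p ih =>
    rintro b c y z hu hv
    obtain ⟨x, b', h1, h2⟩ := BT_adj.1 ha
    obtain ⟨w, h3, h4, h5⟩ := ih (!b') c x z h2 hv
    obtain ⟨rfl, h6⟩ := vt_eq.1 (hu.symm.trans h1)
    exact ⟨(y⁻¹ * x) :: w, List.forall_mem_cons.2 ⟨⟨_, h6⟩, h3⟩, by simp [h4], by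
      simp [h5, mul_assoc]⟩

theorem BT_connected (hF : IsAmalgam L G) : (BT L G).Connected := by
  have : Nonempty (BV L G) := ⟨vt L G true 1⟩
  refine ⟨?_⟩
  intro u v
  obtain ⟨b, y, rfl⟩ := vt_surj u
  obtain ⟨c, z, rfl⟩ := vt_surj v
  obtain ⟨w, hw, he⟩ := exists_word hF (y⁻¹ * z)
  obtain ⟨p, -⟩ := word_walk w hw _ (vt L G c z) b c y rfl (by rw [he, mul_inv_cancel_left])
  exact ⟨p⟩

/-- Nonbacktracking walks give canonical words. -/
theorem walk_canon {u v : BV L G} (p : (BT L G).Walk u v) : ∀ (a : BV L G)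
    (ha : (BT L G).Adj a u) (b : Bool) (y : F), a = vt L G b y → u = vt L G (!b) y →
    (SimpleGraph.Walk.cons ha p).edges.IsChain (· ≠ ·) →
    ∃ (w : List F) (c : Bool) (y' : F), IsCanonicalWord L G w ∧ w.length = p.length ∧
      v = vt L G c y' ∧ w.prod = y⁻¹ * y' ∧
      ∀ x ∈ w.head?, x ∈ fac L G (!b) ∧ x ∉ fac L G b := by
  induction p with
  | nil =>
    rintro a ha b y rfl rfl -
    exact ⟨[], !b, y, canon_nil, by simp, rfl, by simp, by simp⟩
  | cons ha' p ih =>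
    rename_i u u' v
    rintro a ha b y rfl rfl hch
    obtain ⟨z, c, h1, h2⟩ := BT_adj.1 ha'
    obtain ⟨rfl, h3⟩ := vt_eq.1 h1
    rw [SimpleGraph.Walk.edges_cons] at hch
    obtain ⟨w, c, y', k1, k2, k3, k4, k5⟩ := ih _ ha' (!b) z h1 h2 (List.isChain_cons.1 hch).2
    rw [Bool.not_not] at k5 h2
    have hne := (List.isChain_cons.1 hch).1
    rw [SimpleGraph.Walk.edges_cons] at hne
    have hne := hne _ (by simp; rfl)
    have h4 : y⁻¹ * z ∉ fac L G b := by
      intro h4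
      apply hne
      have : vt L G b y = u' := by rw [h2]; exact vt_eq.2 ⟨rfl, h4⟩
      rw [this, Sym2.eq_swap]
    refine ⟨(y⁻¹ * z) :: w, c, y', canon_cons.2 ⟨⟨_, h3⟩, ?_, k1⟩, by simp [k2], k3,
      by simp [k4, mul_assoc], ?_⟩
    · intro x hx
      refine not_same (b := !b) ?_ (k5 x hx).2
      rwa [Bool.not_not]
    · intro x hx
      simp only [List.head?_cons, Option.mem_def, Option.some.injEq] at hx
      subst hx
      exact ⟨h3, h4⟩

theorem BT_tree (hF : IsAmalgam L G) : (BT L G).IsTree := by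
  refine ⟨BT_connected hF, ?_⟩
  intro v c hc
  have h3 := hc.three_le_length
  have hch : c.edges.IsChain (· ≠ ·) := hc.edges_nodup.isChain
  cases c with
  | nil => simp at h3
  | cons ha p =>
    obtain ⟨y, b, h1, h2⟩ := BT_adj.1 ha
    obtain ⟨w, c, y', k1, k2, k3, k4, -⟩ := walk_canon p _ ha b y h1 h2 hch
    obtain ⟨rfl, h⟩ := vt_eq.1 (h1.symm.trans k3)
    simp only [SimpleGraph.Walk.length_cons] at h3
    exact canon_not_mem hF k1 (by omega) b (k4 ▸ h)

end Words
end AmalgamFormalization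

namespace AmalgamFormalization

section Final

variable {F : Type*} [Group F] {L G : Subgroup F}

/-- distance in the Bass–Serre tree -/
noncomputable def bd (L G : Subgroup F) (x y : BV L G) : ℕ := (BT L G).dist x y

theorem bd_tree (hF : IsAmalgam L G) : TreeDist (bd L G) := treeDist_of_isTree (BT_tree hF)

theorem bd_smul_le (hF : IsAmalgam L G) (g : F) (x y : BV L G) :
    bd L G (g • x) (g • y) ≤ bd L G x y := by
  let f : BT L G →g BT L G := ⟨fun v => g • v, by
    rintro u v ⟨z, b, rfl, rfl⟩
    exact ⟨g * z, b, rfl, rfl⟩⟩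
  obtain ⟨p, hp⟩ := (BT_connected hF).exists_walk_length_eq_dist x y
  have := SimpleGraph.dist_le (p.map f)
  rw [SimpleGraph.Walk.length_map, hp] at this
  exact this

theorem bd_iso (hF : IsAmalgam L G) (g : F) (x y : BV L G) :
    bd L G (g • x) (g • y) = bd L G x y := by
  refine le_antisymm (bd_smul_le hF g x y) ?_
  simpa using bd_smul_le hF g⁻¹ (g • x) (g • y)

theorem bd_edge {u v : BV L G} (h : bd L G u v = 1) :
    ∃ x b, u = vt L G b x ∧ v = vt L G (!b) x :=
  BT_adj.1 (SimpleGraph.dist_eq_one_iff_adj.1 h)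

theorem bd_ne_one (g : F) (z : BV L G) : bd L G z (g • z) ≠ 1 := by
  intro h
  obtain ⟨x, b, h1, h2⟩ := bd_edge h
  subst h1
  rw [vt_smul] at h2
  have := (vt_eq.1 h2).1
  cases b <;> simp at this

theorem len_le_bd (hF : IsAmalgam L G) (b c : Bool) (y z : F) :
    len L G (y⁻¹ * z) ≤ bd L G (vt L G b y) (vt L G c z) + 1 := by
  obtain ⟨p, hp⟩ := (BT_connected hF).exists_walk_length_eq_dist (vt L G b y) (vt L G c z)
  obtain ⟨w, h1, h2, h3⟩ := walk_word p b c y z rfl rfl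
  have := len_le_of_word h1
  rw [h3, h2, hp] at this
  exact this

theorem bd_le_len (hF : IsAmalgam L G) (b c : Bool) (y z : F) :
    bd L G (vt L G b y) (vt L G c z) ≤ len L G (y⁻¹ * z) + 1 := by
  obtain ⟨w, ⟨h1, h2⟩, h3⟩ := exists_len hF (y⁻¹ * z)
  obtain ⟨p, hp, -⟩ := word_walk w (canon_iff.1 h1).1 _ (vt L G c z) b c y rfl
    (by rw [h2, mul_inv_cancel_left])
  rw [← h3]
  exact (SimpleGraph.dist_le p).trans hp

theorem word_disp (w : List F) (hw : Lett L G w) :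
    ∃ b, bd L G (vt L G b 1) (w.prod • vt L G b 1) ≤ w.length := by
  rcases w with _ | ⟨x, w⟩
  · exact ⟨true, by simp [bd]⟩
  · obtain ⟨b, hb⟩ := hw x (by simp)
    obtain ⟨p, -, hp⟩ := word_walk (x :: w) hw _ ((x :: w).prod • vt L G b 1) b b 1 rfl (by
      rw [vt_smul, one_mul, mul_one])
    exact ⟨b, (SimpleGraph.dist_le p).trans (hp x (by simp) hb)⟩

theorem len_disp (hF : IsAmalgam L G) (x : F) :
    ∃ b, bd L G (vt L G b 1) (x • vt L G b 1) ≤ len L G x := by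
  obtain ⟨w, ⟨h1, rfl⟩, h3⟩ := exists_len hF x
  rw [← h3]
  exact word_disp w (canon_iff.1 h1).1

variable {R : Set F} {lam : ℝ}

/-- conjugates of relators -/
abbrev RC (R : Set F) : Set F := Group.conjugatesOfSet R

theorem mem_RC {g : F} : g ∈ RC R ↔ ∃ r ∈ R, ∃ c, c * r * c⁻¹ = g := by
  simp [RC, Group.mem_conjugatesOfSet_iff, isConj_iff]

theorem RC_conj (c g : F) (hg : g ∈ RC R) : c * g * c⁻¹ ∈ RC R := by
  obtain ⟨r, hr, x, rfl⟩ := mem_RC.1 hg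
  exact mem_RC.2 ⟨r, hr, c * x, by group⟩

theorem RC_conj' (c g : F) (hg : g ∈ RC R) : c⁻¹ * g * c ∈ RC R := by
  simpa using RC_conj c⁻¹ g hg

theorem RC_inv (hsym : IsSymmetrized L G R) (g : F) (hg : g ∈ RC R) : g⁻¹ ∈ RC R := by
  obtain ⟨r, hr, x, rfl⟩ := mem_RC.1 hg
  exact mem_RC.2 ⟨r⁻¹, hsym.2 r hr, x, by group⟩

theorem RC_mem (hsym : IsSymmetrized L G R) {g : F} (hg : g ∈ RC R)
    (h : IsWeaklyCyclicallyReduced L G g) : g ∈ R := by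
  obtain ⟨r, hr, x, rfl⟩ := mem_RC.1 hg
  exact hsym.1.2 x r hr h

theorem tau_two (hF : IsAmalgam L G) (hlam0 : 0 < lam) (hlam6 : lam ≤ 1 / 6)
    (hsym : IsSymmetrized L G R) (hC : CondC' L G R lam) {g : F} (hg : g ∈ RC R) :
    2 ≤ tau (bd L G) g := by
  have : Nonempty (BV L G) := ⟨vt L G true 1⟩
  obtain ⟨z, hz⟩ := Ax_ne (d := bd L G) g
  have hz' : bd L G z (g • z) = tau (bd L G) g := hz
  have h1 := bd_ne_one g z
  by_contra hcon
  have h0 : bd L G z (g • z) = 0 := by omega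
  have h0 := (bd_tree hF).eq_of _ _ h0
  obtain ⟨b, x, rfl⟩ := vt_surj z
  rw [vt_smul] at h0
  have h2 := (vt_eq.1 h0).2
  have h3 : len L G (x⁻¹ * g * x) ≤ 1 := by
    have := len_le_of_word (L := L) (G := G) (w := [x⁻¹ * g * x]) (fun y hy => ⟨b, by
      rw [List.mem_singleton.1 hy, mul_assoc]; exact h2⟩)
    simpa using this
  have h4 := hC.1 _ (RC_mem hsym (RC_conj' x g hg) (Or.inl h3))
  have h5 : (6 : ℝ) ≤ 1 / lam := by
    rw [le_div_iff₀ hlam0]; linarith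
  have h6 : (len L G (x⁻¹ * g * x) : ℝ) ≤ 1 := by exact_mod_cast h3
  linarith

/-- An element which starts along its axis from the base edge is a relator. -/
theorem axis_relator (hF : IsAmalgam L G) (hlam0 : 0 < lam) (hlam6 : lam ≤ 1 / 6)
    (hsym : IsSymmetrized L G R) (hC : CondC' L G R lam) {g : F} (hg : g ∈ RC R)
    {b : Bool} {x : F} (h : tau (bd L G) g = bd L G (vt L G (!b) x) (g • vt L G b x) + 1) :
    len L G (x⁻¹ * (g * x)) = tau (bd L G) g ∧ x⁻¹ * (g * x) ∈ R := by
  have h2 := tau_two hF hlam0 hlam6 hsym hC hg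
  have hup := len_le_bd hF (!b) b x (g * x)
  rw [← vt_smul, ← h] at hup
  have htc : tau (bd L G) (x⁻¹ * (g * x)) = tau (bd L G) g := by
    have := tau_conj (bd_iso hF) x⁻¹ g
    simpa [mul_assoc] using this
  have hRC : x⁻¹ * (g * x) ∈ RC R := by
    have := RC_conj' x g hg
    rwa [mul_assoc] at this
  generalize x⁻¹ * (g * x) = r at *
  obtain ⟨c, hc⟩ := len_disp hF r
  have h3 := tau_le (d := bd L G) r (vt L G c 1)
  have hlen : len L G r = tau (bd L G) g := by omega
  refine ⟨hlen, RC_mem hsym hRC (Or.inr ?_)⟩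
  obtain ⟨w, ⟨hw, hp⟩, hl⟩ := exists_len hF r
  refine ⟨w, ⟨hw, hp⟩, ?_⟩
  intro s t hs ht hst
  rcases w with _ | ⟨s', w⟩
  · simp at hs
  simp only [List.head?_cons, Option.some.injEq] at hs
  subst hs
  rcases List.eq_nil_or_concat w with rfl | ⟨w, t', rfl⟩
  · simp at hl; omega
  rw [List.concat_eq_append, ← List.cons_append, List.getLast?_append] at ht
  simp only [List.getLast?_singleton, Option.some_or, Option.some.injEq] at ht
  subst ht
  have hlett := (canon_iff.1 hw).1
  obtain ⟨e, hse⟩ := hlett s' (by simp)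
  have hte : t' ∈ fac L G e := (Subgroup.mul_mem_cancel_left _ hse).1 (mem_inf_iff.1 hst e)
  obtain ⟨f, hf⟩ := word_disp (L := L) (G := G) ((t' * s') :: w) (by
    intro y hy
    rcases List.mem_cons.1 hy with rfl | hy
    · exact ⟨e, mul_mem hte hse⟩
    · exact hlett y (by simp [hy]))
  have h4 := tau_le (d := bd L G) ((t' * s') :: w).prod (vt L G f 1)
  have h5 : ((t' * s') :: w).prod = t' * r * t'⁻¹ := by
    rw [← hp]; simp [mul_assoc]
  rw [h5, tau_conj (bd_iso hF)] at h4
  rw [h5] at hf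
  simp only [List.length_cons, List.concat_eq_append, List.length_append, List.length_nil] at hl hf
  omega

theorem tau_gt (hF : IsAmalgam L G) (hlam0 : 0 < lam) (hlam6 : lam ≤ 1 / 6)
    (hsym : IsSymmetrized L G R) (hC : CondC' L G R lam) {g : F} (hg : g ∈ RC R) :
    1 / lam < (tau (bd L G) g : ℝ) := by
  have : Nonempty (BV L G) := ⟨vt L G true 1⟩
  have h2 := tau_two hF hlam0 hlam6 hsym hC hg
  obtain ⟨z, hz⟩ := Ax_ne (d := bd L G) g
  have hz' : bd L G z (g • z) = tau (bd L G) g := hz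
  obtain ⟨z', h3, h4⟩ := (bd_tree hF).nb z (g • z) (by omega)
  obtain ⟨x, b, rfl, rfl⟩ := bd_edge h3
  obtain ⟨h5, h6⟩ := axis_relator hF hlam0 hlam6 hsym hC hg (b := b) (x := x) (by omega)
  rw [← h5]
  exact hC.1 _ h6

/-- Common segments are pieces. -/
theorem piece (hF : IsAmalgam L G) (hlam0 : 0 < lam) (hlam6 : lam ≤ 1 / 6)
    (hsym : IsSymmetrized L G R) (hC : CondC' L G R lam) {g g' : F} (hg : g ∈ RC R)
    (hg' : g' ∈ RC R) (hne : g ≠ g') {u v : BV L G} (hu : u ∈ Ax (bd L G) g)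
    (hu' : u ∈ Ax (bd L G) g') (h0 : 0 < bd L G u v) (hlt : bd L G u v < tau (bd L G) g)
    (h1 : bd L G u (g • u) = bd L G u v + bd L G v (g • u))
    (h2 : bd L G u (g' • u) = bd L G u v + bd L G v (g' • u)) :
    (bd L G u v : ℝ) < lam * tau (bd L G) g := by
  have T := bd_tree hF
  have hu : bd L G u (g • u) = tau (bd L G) g := hu
  have hu' : bd L G u (g' • u) = tau (bd L G) g' := hu'
  obtain ⟨u1, a1, a2⟩ := T.nb u v (by omega)
  obtain ⟨v1, c1, c2⟩ := T.nb v (g • u) (by omega)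
  obtain ⟨x, b, rfl, rfl⟩ := bd_edge a1
  obtain ⟨z, c, rfl, rfl⟩ := bd_edge c1
  have t1 := T.tri (vt L G b x) (vt L G (!b) x) (g • vt L G b x)
  have t2 := T.tri (vt L G (!b) x) (vt L G c z) (g • vt L G b x)
  have t3 := T.tri (vt L G b x) (vt L G (!b) x) (g' • vt L G b x)
  have t4 := T.tri (vt L G (!b) x) (vt L G c z) (g' • vt L G b x)
  have t5 := T.tri (vt L G b x) (vt L G (!c) z) (g • vt L G b x)
  obtain ⟨l1, r1⟩ := axis_relator hF hlam0 hlam6 hsym hC hg (b := b) (x := x) (by omega)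
  obtain ⟨l2, r2⟩ := axis_relator hF hlam0 hlam6 hsym hC hg' (b := b) (x := x) (by omega)
  have k1 := len_le_bd hF (!b) c x z
  have k2 := len_le_bd hF c b z (g * x)
  have k3 := len_le_bd hF c b z (g' * x)
  have k4 := bd_le_len hF b (!c) x z
  rw [← vt_smul] at k2 k3
  have m1 := len_mul_le hF (x⁻¹ * z) (z⁻¹ * (g * x))
  have m2 := len_mul_le hF (x⁻¹ * z) (z⁻¹ * (g' * x))
  have e1 : x⁻¹ * z * (z⁻¹ * (g * x)) = x⁻¹ * (g * x) := by group
  have e2 : x⁻¹ * z * (z⁻¹ * (g' * x)) = x⁻¹ * (g' * x) := by group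
  rw [e1] at m1
  rw [e2] at m2
  have hp : IsPieceOf L G R (x⁻¹ * z) (x⁻¹ * (g * x)) := by
    refine ⟨x⁻¹ * (g' * x), r2, ?_, ⟨z⁻¹ * (g * x), e1.symm, ?_, m1⟩,
      ⟨z⁻¹ * (g' * x), e2.symm, ?_, m2⟩⟩
    · intro h
      have := mul_right_cancel (mul_left_cancel h)
      exact hne this.symm
    · omega
    · omega
  have hlt' := hC.2 _ r1 _ hp
  rw [l1] at hlt'
  refine lt_of_le_of_lt ?_ hlt'
  have : bd L G (vt L G b x) (vt L G c z) ≤ len L G (x⁻¹ * z) := by omega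
  exact_mod_cast this

theorem ax_overlap (hF : IsAmalgam L G) (hlam0 : 0 < lam) (hlam6 : lam ≤ 1 / 6)
    (hsym : IsSymmetrized L G R) (hC : CondC' L G R lam) {g g' : F} (hg : g ∈ RC R)
    (hg' : g' ∈ RC R) (hne : g' ≠ g) (hne' : g' ≠ g⁻¹) {x y : BV L G} (hx : x ∈ Ax (bd L G) g)
    (hx' : x ∈ Ax (bd L G) g') (hy : y ∈ Ax (bd L G) g) (hy' : y ∈ Ax (bd L G) g') :
    (bd L G x y : ℝ) < lam * tau (bd L G) g := by
  by_contra hcon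
  push Not at hcon
  have T := bd_tree hF
  have iso := bd_iso hF
  have t1 := tau_two hF hlam0 hlam6 hsym hC hg
  have t2 := tau_two hF hlam0 hlam6 hsym hC hg'
  have s1 : (2 : ℝ) ≤ tau (bd L G) g := by exact_mod_cast t1
  have s2 : (2 : ℝ) ≤ tau (bd L G) g' := by exact_mod_cast t2
  obtain ⟨μ, hμ1, hμ2, hμ3⟩ : ∃ μ : ℕ, μ ≤ tau (bd L G) g ∧ μ ≤ tau (bd L G) g' ∧
      (μ = tau (bd L G) g ∨ μ = tau (bd L G) g') := by
    rcases le_total (tau (bd L G) g) (tau (bd L G) g') with h | h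
    · exact ⟨_, le_rfl, h, Or.inl rfl⟩
    · exact ⟨_, h, le_rfl, Or.inr rfl⟩
  have hμ4 : 2 ≤ μ := by omega
  have r1 : (μ : ℝ) ≤ tau (bd L G) g := by exact_mod_cast hμ1
  have r4 : (2 : ℝ) ≤ μ := by exact_mod_cast hμ4
  have hkd : ⌈lam * μ⌉₊ ≤ bd L G x y := by
    rw [Nat.ceil_le]
    exact le_trans (mul_le_mul_of_nonneg_left r1 hlam0.le) hcon
  have hkμ : ⌈lam * μ⌉₊ < μ := by
    have h1 : (⌈lam * μ⌉₊ : ℝ) < lam * μ + 1 := Nat.ceil_lt_add_one (by positivity)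
    have h2 : lam * μ ≤ 1 / 6 * μ := mul_le_mul_of_nonneg_right hlam6 (by positivity)
    have : (⌈lam * μ⌉₊ : ℝ) < μ := by linarith
    exact_mod_cast this
  have hk0 : 0 < ⌈lam * μ⌉₊ := Nat.ceil_pos.2 (by positivity)
  have hkc := Nat.le_ceil (lam * μ)
  generalize ⌈lam * (μ : ℝ)⌉₊ = k at *
  obtain ⟨v, v1, v2⟩ := point_at T x y k hkd
  have hv := Ax_conv T iso g x hx y hy v v2
  have hv' := Ax_conv T iso g' x hx' y hy' v v2
  have orient : ∀ f ∈ RC R, x ∈ Ax (bd L G) f → v ∈ Ax (bd L G) f → k < tau (bd L G) f →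
      ∃ f1 ∈ RC R, (f1 = f ∨ f1 = f⁻¹) ∧ x ∈ Ax (bd L G) f1 ∧
        tau (bd L G) f1 = tau (bd L G) f ∧
        bd L G x (f1 • x) = bd L G x v + bd L G v (f1 • x) := by
    intro f hf hxf hvf hkf
    have := tau_two hF hlam0 hlam6 hsym hC hf
    rcases Ax_line T iso this hxf hvf (by omega) with h | h
    · exact ⟨f, hf, Or.inl rfl, hxf, rfl, h⟩
    · exact ⟨f⁻¹, RC_inv hsym f hf, Or.inr rfl, by rw [Ax_inv T iso]; exact hxf,
        tau_inv T iso f, h⟩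
  obtain ⟨f, f1, f2, f3, f4, f5⟩ := orient g hg hx hv (by omega)
  obtain ⟨f', f1', f2', f3', f4', f5'⟩ := orient g' hg' hx' hv' (by omega)
  have hff : f ≠ f' := by
    rintro rfl
    rcases f2 with h | h <;> rcases f2' with h' | h'
    · exact hne (h'.symm.trans h)
    · exact hne' (by rw [← h, h', inv_inv])
    · exact hne' (h'.symm.trans h)
    · exact hne (inv_injective (h'.symm.trans h))
  have q1 := piece hF hlam0 hlam6 hsym hC f1 f1' hff f3 f3' (by omega) (by omega) f5 f5'
  have q2 := piece hF hlam0 hlam6 hsym hC f1' f1 hff.symm f3' f3 (by omega) (by omega) f5' f5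
  rw [v1, f4] at q1
  rw [v1, f4'] at q2
  rcases hμ3 with h | h
  · rw [h] at hkc; linarith
  · rw [h] at hkc; linarith

theorem axisFamily (hF : IsAmalgam L G) (hlam0 : 0 < lam) (hlam6 : lam ≤ 1 / 6)
    (hsym : IsSymmetrized L G R) (hC : CondC' L G R lam) :
    AxisFamily (bd L G) lam (RC R) (Ax (bd L G)) (tau (bd L G)) where
  T := bd_tree hF
  iso := bd_iso hF
  lam0 := hlam0
  lam6 := hlam6
  conj c g hg := RC_conj c g hg
  Aconj c g x hx := Ax_conj (bd_iso hF) c g x hx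
  τconj c g := tau_conj (bd_iso hF) c g
  τpos g hg := by
    have := tau_two hF hlam0 hlam6 hsym hC hg
    omega
  ne g _ := by
    have : Nonempty (BV L G) := ⟨vt L G true 1⟩
    exact Ax_ne g
  conv g _ := Ax_conv (bd_tree hF) (bd_iso hF) g
  disp g hg t ht h1 y hy :=
    Ax_disp (bd_tree hF) (bd_iso hF) (tau_two hF hlam0 hlam6 hsym hC hg) ht h1 hy
  overlap g hg g' hg' h1 h2 x y a1 a2 a3 a4 :=
    ax_overlap hF hlam0 hlam6 hsym hC hg hg' h1 h2 a1 a2 a3 a4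

theorem len_gt (hF : IsAmalgam L G) (hlam0 : 0 < lam) (hlam6 : lam ≤ 1 / 6)
    (hsym : IsSymmetrized L G R) (hC : CondC' L G R lam) {w : F}
    (hw : w ∈ Subgroup.normalClosure R) (h1 : w ≠ 1) : 1 / lam - 3 < (len L G w : ℝ) := by
  obtain ⟨b, hb⟩ := len_disp hF w
  have hm := (axisFamily hF hlam0 hlam6 hsym hC).main (K := 1 / lam - 3) (vt L G b 1) (by
    intro g hg
    have h2 := tau_gt hF hlam0 hlam6 hsym hC hg
    have h3 : (1 - 3 * lam) * (1 / lam) ≤ (1 - 3 * lam) * tau (bd L G) g :=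
      mul_le_mul_of_nonneg_left h2.le (by linarith)
    have h4 : (1 - 3 * lam) * (1 / lam) = 1 / lam - 3 := by field_simp
    linarith) hw h1
  refine lt_of_lt_of_le hm ?_
  exact_mod_cast hb

end Final

/-- Lemma 3.5: properties of the quotient of an amalgamated free product by the normal
closure of a symmetrized set satisfying `C'(λ)` with `λ ≤ 1/6`. -/
theorem quotient_of_smallCancellation
    {F : Type u} [Group F] (L G : Subgroup F) (hF : IsAmalgam L G)
    (R : Set F) (lam : ℝ) (hlam0 : 0 < lam) (hlam6 : lam ≤ 1 / 6)
    (hsym : IsSymmetrized L G R) (hC : CondC' L G R lam) :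
    (∀ w ∈ Subgroup.normalClosure R, w ≠ 1 →
        (1 / lam - 3 : ℝ) < (len L G w : ℝ) ∧ (3 : ℝ) ≤ 1 / lam - 3) ∧
    Set.InjOn (QuotientGroup.mk' (Subgroup.normalClosure R)) ((L : Set F) ∪ (G : Set F)) ∧
    QuotientGroup.mk' (Subgroup.normalClosure R) '' ((L ⊓ G : Subgroup F) : Set F) =
      QuotientGroup.mk' (Subgroup.normalClosure R) '' (L : Set F) ∩
        QuotientGroup.mk' (Subgroup.normalClosure R) '' (G : Set F) := by
  have h6 : (3 : ℝ) ≤ 1 / lam - 3 := by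
    have : (6 : ℝ) ≤ 1 / lam := by
      rw [le_div_iff₀ hlam0]; linarith
    linarith
  have hinj : Set.InjOn (QuotientGroup.mk' (Subgroup.normalClosure R))
      ((L : Set F) ∪ (G : Set F)) := by
    intro x hx y hy hxy
    have hN : x⁻¹ * y ∈ Subgroup.normalClosure R := QuotientGroup.eq.1 hxy
    by_contra hne
    have h1 : x⁻¹ * y ≠ 1 := fun h => hne (inv_mul_eq_one.1 h)
    have h2 := len_gt hF hlam0 hlam6 hsym hC hN h1
    obtain ⟨b, hb⟩ := mem_union_iff.1 hx
    have h3 := len_le_of_word (L := L) (G := G) (w := [x⁻¹, y])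
      (List.forall_mem_cons.2 ⟨⟨b, inv_mem hb⟩, fun z hz => by
        rw [List.mem_singleton.1 hz]; exact mem_union_iff.1 hy⟩)
    simp only [List.prod_cons, List.prod_nil, mul_one, List.length_cons, List.length_nil] at h3
    have h4 : (len L G (x⁻¹ * y) : ℝ) ≤ 2 := by exact_mod_cast h3
    linarith
  refine ⟨fun w hw h1 => ⟨len_gt hF hlam0 hlam6 hsym hC hw h1, h6⟩, hinj, ?_⟩
  apply Set.Subset.antisymm
  · rintro _ ⟨x, hx, rfl⟩
    exact ⟨⟨x, (Subgroup.mem_inf.1 hx).1, rfl⟩, ⟨x, (Subgroup.mem_inf.1 hx).2, rfl⟩⟩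
  · rintro _ ⟨⟨x, hx, rfl⟩, ⟨y, hy, hxy⟩⟩
    have := hinj (Or.inr hy) (Or.inl hx) hxy
    subst this
    exact ⟨y, Subgroup.mem_inf.2 ⟨hx, hy⟩, rfl⟩

end AmalgamFormalization
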